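/- arXiv:1410.0641 — 3 statements merged into one kernel-verified Lean document; each statement's English description precedes it below -/
import Mathlib

section
/- In the setting of Problem 1, choose μ > 0, α̲ > 0 and β ≥ 0 satisfying μ(σ − L_{∇g}α̲) > β(μ² + 1), define M_1 = (σ − ᾱL_{∇g})/(2ᾱ) − μβ/(2α̲) and M_2 = β/(2μα̲), and choose ᾱ > α̲ such that M_1 > M_2. Assume f + g is coercive, i.e. lim_{‖x‖→+∞}(f+g)(x) = +∞. Then the sequence (x_n)_{n∈ℕ} generated by Algorithm 1 is bounded, it has a subsequence converging to a critical point of f + g, and every cluster point of (x_n)_{n∈ℕ} is a critical point of f + g. -/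
open Filter Topology RealInnerProductSpace

noncomputable section

variable {E : Type*} [NormedAddCommGroup E] [InnerProductSpace ℝ E]

/-- The Fréchet (viscosity) subdifferential of an extended-real-valued function `h` at `x`:
`v` belongs to it iff `x ∈ dom h` and
`liminf_{y → x} (h y - h x - ⟪v, y - x⟫)/‖y - x‖ ≥ 0`, expressed equivalently by the
epsilon-characterization of the liminf. -/
def frechetSubdiff (h : E → EReal) (x : E) : Set E :=
  {v | h x ≠ ⊤ ∧ ∀ ε : ℝ, 0 < ε →
    ∀ᶠ y in 𝓝 x, (((h x).toReal + ⟪v, y - x⟫ - ε * ‖y - x‖ : ℝ) : EReal) ≤ h y}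

/-- The limiting (Mordukhovich) subdifferential of `h` at `x`. -/
def limitingSubdiff (h : E → EReal) (x : E) : Set E :=
  {v | h x ≠ ⊤ ∧ ∃ xk vk : ℕ → E,
    Tendsto xk atTop (𝓝 x) ∧
    Tendsto (fun k => h (xk k)) atTop (𝓝 (h x)) ∧
    (∀ k, vk k ∈ frechetSubdiff h (xk k)) ∧
    Tendsto vk atTop (𝓝 v)}

lemma le_add_inner_add_sq_of_lipschitz_gradient [CompleteSpace E] {g : E → ℝ} {L : ℝ}
    (hg : Differentiable ℝ g) (hlip : ∀ z w, ‖gradient g z - gradient g w‖ ≤ L * ‖z - w‖)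
    (x y : E) : g y ≤ g x + ⟪gradient g x, y - x⟫ + L / 2 * ‖y - x‖ ^ 2 := by
  have hd : ∀ t : ℝ, HasDerivAt
      (fun t : ℝ => g (x + t • (y - x)) - t * ⟪gradient g x, y - x⟫ - L / 2 * t ^ 2 * ‖y - x‖ ^ 2)
      (⟪gradient g (x + t • (y - x)), y - x⟫ - ⟪gradient g x, y - x⟫ - L * t * ‖y - x‖ ^ 2) t := by
    intro t
    have h1 : HasDerivAt (fun t : ℝ => x + t • (y - x)) (y - x) t := by
      simpa using ((hasDerivAt_id t).smul_const (y - x)).const_add x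
    have h2 := (hg (x + t • (y - x))).hasGradientAt.hasFDerivAt.comp_hasDerivAt t h1
    have h3 := (hasDerivAt_id t).mul_const ⟪gradient g x, y - x⟫
    have h4 := (((hasDerivAt_id t).pow 2).const_mul (L / 2)).mul_const (‖y - x‖ ^ 2)
    refine ((h2.sub h3).sub h4).congr_deriv ?_
    rw [InnerProductSpace.toDual_apply_apply]
    simp only [id, Nat.cast_ofNat]
    ring
  have hanti : AntitoneOn
      (fun t : ℝ => g (x + t • (y - x)) - t * ⟪gradient g x, y - x⟫ - L / 2 * t ^ 2 * ‖y - x‖ ^ 2)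
      (Set.Ici 0) := by
    refine antitoneOn_of_deriv_nonpos (convex_Ici 0)
      (fun t _ => (hd t).continuousAt.continuousWithinAt)
      (fun t _ => (hd t).differentiableAt.differentiableWithinAt) fun t ht => ?_
    rw [interior_Ici, Set.mem_Ioi] at ht
    rw [(hd t).deriv, ← inner_sub_left]
    have h1 := real_inner_le_norm (gradient g (x + t • (y - x)) - gradient g x) (y - x)
    have h2 := hlip (x + t • (y - x)) x
    rw [add_sub_cancel_left, norm_smul, Real.norm_of_nonneg ht.le] at h2
    have h3 := mul_le_mul_of_nonneg_right h2 (norm_nonneg (y - x))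
    nlinarith
  have := hanti (Set.mem_Ici.2 le_rfl) (Set.mem_Ici.2 zero_le_one) zero_le_one
  simp only [one_smul, zero_smul, add_sub_cancel, add_zero] at this
  linarith

lemma ConvexOn.add_inner_gradient_le [CompleteSpace E] {h : E → ℝ} {v x : E}
    (hc : ConvexOn ℝ Set.univ h) (hv : HasGradientAt h v x) (y : E) :
    h x + ⟪v, y - x⟫ ≤ h y := by
  have h1 : HasDerivAt (fun t : ℝ => x + t • (y - x)) (y - x) 0 := by
    simpa using ((hasDerivAt_id (0 : ℝ)).smul_const (y - x)).const_add x
  have hv' : HasGradientAt h v (x + (0 : ℝ) • (y - x)) := by simpa using hv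
  have h2 := hv'.hasFDerivAt.comp_hasDerivAt 0 h1
  have h3 : ConvexOn ℝ Set.univ (h ∘ fun t : ℝ => x + t • (y - x)) := by
    have heq : (fun t : ℝ => x + t • (y - x)) = AffineMap.lineMap x y := by
      ext1 t
      simp [AffineMap.lineMap_apply, add_comm]
    rw [heq]
    exact hc.comp_affineMap (AffineMap.lineMap x y : ℝ →ᵃ[ℝ] E)
  have := h3.le_slope_of_hasDerivAt (Set.mem_univ 0) (Set.mem_univ 1) zero_lt_one h2
  simp [slope_def_field] at this
  linarith

lemma add_inner_gradient_add_sq_le_of_strongly_convex [CompleteSpace E] {F : E → ℝ} {σ : ℝ}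
    (hconv : ConvexOn ℝ Set.univ fun z => F z - σ / 2 * ‖z‖ ^ 2) (hF : Differentiable ℝ F)
    (x y : E) : F x + ⟪gradient F x, y - x⟫ + σ / 2 * ‖y - x‖ ^ 2 ≤ F y := by
  have hv : HasGradientAt (fun z => F z - σ / 2 * ‖z‖ ^ 2) (gradient F x - σ • x) x := by
    rw [hasGradientAt_iff_hasFDerivAt]
    refine ((hF x).hasGradientAt.hasFDerivAt.sub
      ((hasStrictFDerivAt_norm_sq x).hasFDerivAt.const_mul (σ / 2))).congr_fderiv ?_
    ext u
    simp
    ring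
  have h1 := hconv.add_inner_gradient_le hv y
  have h2 := norm_sub_sq_real y x
  rw [inner_sub_left, inner_smul_left, inner_sub_right x, real_inner_self_eq_norm_sq,
    RCLike.conj_to_real, real_inner_comm y x] at h1
  rw [h2]
  linarith

lemma gradient_sub_mem_frechetSubdiff [CompleteSpace E] {f : E → EReal} {F g : E → ℝ} {x c : E}
    {a r : ℝ} (hbot : ∀ z, f z ≠ ⊥) (hx : f x = (r : EReal)) (ha : 0 < a)
    (hF : DifferentiableAt ℝ F x) (hg : DifferentiableAt ℝ g x)
    (hmin : ∀ (u : E) (t : ℝ), f u = (t : EReal) →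
      F x + ⟪c, x⟫ + a * r ≤ F u + ⟪c, u⟫ + a * t) :
    gradient g x - a⁻¹ • (gradient F x + c) ∈
      frechetSubdiff (fun z => f z + ((g z : ℝ) : EReal)) x := by
  refine ⟨?_, fun ε hε => ?_⟩
  · simp only [hx, ← EReal.coe_add]
    exact EReal.coe_ne_top _
  have hφ : HasFDerivAt (fun z => g z - a⁻¹ * F z)
      (InnerProductSpace.toDual ℝ E (gradient g x)
        - a⁻¹ • InnerProductSpace.toDual ℝ E (gradient F x)) x :=
    hg.hasGradientAt.hasFDerivAt.sub (hF.hasGradientAt.hasFDerivAt.const_mul a⁻¹)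
  filter_upwards [hφ.isLittleO.def hε] with y hy
  by_cases hy' : f y = ⊤
  · simp [hy']
  lift f y to ℝ using ⟨hy', hbot y⟩ with t ht
  simp only [hx, ← EReal.coe_add, EReal.toReal_coe, EReal.coe_le_coe_iff]
  have h1 := mul_le_mul_of_nonneg_left (hmin y t ht.symm) (inv_pos.2 ha).le
  have h2 := (abs_le.1 (Real.norm_eq_abs _ ▸ hy)).1
  simp only [mul_add, inv_mul_cancel_left₀ ha.ne'] at h1
  simp only [_root_.sub_apply, _root_.smul_apply,
    InnerProductSpace.toDual_apply_apply, smul_eq_mul] at h2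
  simp only [inner_sub_left, inner_smul_left, inner_add_left, inner_sub_right,
    RCLike.conj_to_real] at h2 ⊢
  linarith

lemma exists_sublevel_subset_closedBall_of_coercive {V : Type*} [Norm V] {h : V → EReal}
    (hcoer : Tendsto h (comap (fun z : V => ‖z‖) atTop) (𝓝 ⊤)) (C : ℝ) :
    ∃ R : ℝ, ∀ z, h z ≤ C → ‖z‖ ≤ R := by
  have h1 := hcoer.eventually (lt_mem_nhds (EReal.coe_lt_top C))
  rw [eventually_comap] at h1
  obtain ⟨R, hR⟩ := eventually_atTop.1 h1
  refine ⟨R, fun z hz => ?_⟩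
  by_contra! hlt
  exact (hR _ hlt.le z rfl).not_ge hz

lemma exists_lower_bound_of_coercive {E : Type*} [NormedAddCommGroup E] [ProperSpace E]
    {f : E → EReal} {g : E → ℝ} {cl : ℝ}
    (hf : ∀ z, (cl : EReal) ≤ f z) (hg : Continuous g)
    (hcoer : Tendsto (fun z => f z + ((g z : ℝ) : EReal)) (comap (fun z : E => ‖z‖) atTop) (𝓝 ⊤)) :
    ∃ B : ℝ, ∀ z, (B : EReal) ≤ f z + ((g z : ℝ) : EReal) := by
  obtain ⟨R, hR⟩ := exists_sublevel_subset_closedBall_of_coercive hcoer 0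
  obtain ⟨b, hb⟩ := (isCompact_closedBall (0 : E) R).bddBelow_image hg.continuousOn
  refine ⟨min 0 (cl + b), fun z => ?_⟩
  rcases le_total (f z + ((g z : ℝ) : EReal)) (0 : ℝ) with hz | hz
  · have h1 : b ≤ g z := hb ⟨z, by simpa using hR z hz, rfl⟩
    calc ((min 0 (cl + b) : ℝ) : EReal) ≤ ((cl + b : ℝ) : EReal) :=
          EReal.coe_le_coe_iff.2 (min_le_right _ _)
      _ = (cl : EReal) + (b : EReal) := EReal.coe_add _ _
      _ ≤ _ := add_le_add (hf z) (EReal.coe_le_coe_iff.2 h1)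
  · exact (EReal.coe_le_coe_iff.2 (min_le_left _ _)).trans hz

lemma energy_bounded_and_tendsto_zero {H d : ℕ → ℝ} {M1 M2 B : ℝ} (hM2 : 0 ≤ M2) (hM : M2 < M1)
    (hB : ∀ n, B ≤ H n)
    (hdec : ∀ n, H (n + 1) + M1 * d (n + 1) ^ 2 ≤ H n + M2 * d n ^ 2) :
    (∀ n, H n ≤ H 0 + M2 * d 0 ^ 2) ∧ Tendsto d atTop (𝓝 0) := by
  have hstep : ∀ n, (M1 - M2) * d (n + 1) ^ 2 ≤
      (H n + M2 * d n ^ 2) - (H (n + 1) + M2 * d (n + 1) ^ 2) := fun n => by linarith [hdec n]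
  have hanti : Antitone fun n => H n + M2 * d n ^ 2 := antitone_nat_of_succ_le fun n => by
    have := mul_nonneg (sub_pos.2 hM).le (sq_nonneg (d (n + 1)))
    linarith [hstep n]
  refine ⟨fun n => ?_, ?_⟩
  · have h1 : H n + M2 * d n ^ 2 ≤ H 0 + M2 * d 0 ^ 2 := hanti (Nat.zero_le n)
    have := mul_nonneg hM2 (sq_nonneg (d n))
    linarith
  have hlim := tendsto_atTop_ciInf hanti ⟨B, by
    rintro _ ⟨n, rfl⟩
    have := mul_nonneg hM2 (sq_nonneg (d n))
    exact (hB n).trans (by simpa using this)⟩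
  have hdiff := hlim.sub (hlim.comp (tendsto_add_atTop_nat 1))
  rw [sub_self] at hdiff
  have hsq := squeeze_zero
    (fun n => mul_nonneg (sub_pos.2 hM).le (sq_nonneg (d (n + 1)))) hstep hdiff
  have hsq' : Tendsto (fun n => d (n + 1) ^ 2) atTop (𝓝 0) := by
    have := hsq.const_mul (M1 - M2)⁻¹
    simpa [(sub_pos.2 hM).ne'] using this
  rw [← tendsto_add_atTop_iff_nat 1, tendsto_zero_iff_abs_tendsto_zero]
  simpa [Real.sqrt_sq_eq_abs, Function.comp_def] using hsq'.sqrt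

lemma descent_step {αlo αhi β σ L μ a b p q r r' s s' : ℝ} (hαlo : 0 < αlo) (ha : αlo ≤ a)
    (ha' : a ≤ αhi) (hb : b ≤ β) (hβ : 0 ≤ β) (hσ : 0 < σ) (hμ : 0 < μ) (hp : 0 ≤ p) (hq : 0 ≤ q)
    (h : σ / 2 * p ^ 2 + a * (s' - s - L / 2 * p ^ 2) - b * (p * q) + a * r' ≤ a * r) :
    r' + s' + ((σ - αhi * L) / (2 * αhi) - μ * β / (2 * αlo)) * p ^ 2
      ≤ r + s + β / (2 * μ * αlo) * q ^ 2 := by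
  have ha0 : 0 < a := hαlo.trans_le ha
  have hhi : 0 < αhi := ha0.trans_le ha'
  have h1 : r' + s' + σ / (2 * a) * p ^ 2 ≤ r + s + L / 2 * p ^ 2 + b / a * (p * q) := by
    have e1 : a * (σ / (2 * a) * p ^ 2) = σ / 2 * p ^ 2 := by field_simp
    have e2 : a * (b / a * (p * q)) = b * (p * q) := by field_simp
    refine le_of_mul_le_mul_left ?_ ha0
    simp only [mul_add, e1, e2]
    linarith
  have h2 : σ / (2 * αhi) * p ^ 2 ≤ σ / (2 * a) * p ^ 2 := by gcongr
  have h3 : b / a * (p * q) ≤ β / αlo * (p * q) := by gcongr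
  have h4 : p * q ≤ μ / 2 * p ^ 2 + 1 / (2 * μ) * q ^ 2 := by
    have e : μ / 2 * p ^ 2 + 1 / (2 * μ) * q ^ 2 - p * q = (μ * p - q) ^ 2 / (2 * μ) := by
      field_simp
      ring
    have : 0 ≤ (μ * p - q) ^ 2 / (2 * μ) := by positivity
    linarith
  have h5 : β / αlo * (p * q) ≤ β / αlo * (μ / 2 * p ^ 2 + 1 / (2 * μ) * q ^ 2) := by gcongr
  have e3 : ((σ - αhi * L) / (2 * αhi) - μ * β / (2 * αlo)) * p ^ 2
      = σ / (2 * αhi) * p ^ 2 - L / 2 * p ^ 2 - β / αlo * (μ / 2 * p ^ 2) := by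
    field_simp
  have e4 : β / (2 * μ * αlo) * q ^ 2 = β / αlo * (1 / (2 * μ) * q ^ 2) := by field_simp
  rw [e3, e4]
  linarith

/-- Lemma 3.4: if `f + g` is coercive then the sequence generated by Algorithm 1 is
bounded, has a subsequence converging to a critical point of `f + g`, and every
cluster point of the sequence is a critical point of `f + g`. -/
theorem stmt9
    (m : ℕ)
    (f : EuclideanSpace ℝ (Fin m) → EReal)
    -- `f` is proper (never `⊥`, somewhere finite), lower semicontinuous and bounded below
    (hfbot : ∀ z, f z ≠ ⊥) (hfproper : ∃ z, f z ≠ ⊤)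
    (hflsc : LowerSemicontinuous f)
    (hfbdd : ∃ cl : ℝ, ∀ z, (cl : EReal) ≤ f z)
    -- `g` is differentiable with `Lg`-Lipschitz gradient
    (g : EuclideanSpace ℝ (Fin m) → ℝ) (Lg : ℝ) (hLg : 0 ≤ Lg)
    (hgdiff : Differentiable ℝ g)
    (hglip : ∀ z w, ‖gradient g z - gradient g w‖ ≤ Lg * ‖z - w‖)
    -- `F` is `σ`-strongly convex and differentiable with `LF`-Lipschitz gradient
    (F : EuclideanSpace ℝ (Fin m) → ℝ) (σ LF : ℝ) (hσ : 0 < σ) (hLF : 0 < LF)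
    (hFconv : ConvexOn ℝ Set.univ fun z => F z - σ / 2 * ‖z‖ ^ 2)
    (hFdiff : Differentiable ℝ F)
    (hFlip : ∀ z w, ‖gradient F z - gradient F w‖ ≤ LF * ‖z - w‖)
    -- parameters of the algorithm
    (αlo αhi β : ℝ) (hαlo : 0 < αlo) (hαorder : αlo ≤ αhi) (hβ : 0 ≤ β)
    (α βs : ℕ → ℝ)
    (hα : ∀ n, 1 ≤ n → αlo ≤ α n ∧ α n ≤ αhi)
    (hβs : ∀ n, 1 ≤ n → 0 ≤ βs n ∧ βs n ≤ β)
    -- the sequence generated by Algorithm 1: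
    -- `x (n+1)` minimizes `u ↦ D_F(u, x n) + α n • ⟪u, ∇g(x n)⟫ + βs n • ⟪u, x (n-1) - x n⟫ + α n • f u`
    (x : ℕ → EuclideanSpace ℝ (Fin m))
    (halg : ∀ n, 1 ≤ n → ∀ u,
      ((F (x (n + 1)) - F (x n) - ⟪gradient F (x n), x (n + 1) - x n⟫
          + α n * ⟪x (n + 1), gradient g (x n)⟫
          + βs n * ⟪x (n + 1), x (n - 1) - x n⟫ : ℝ) : EReal)
        + (α n : EReal) * f (x (n + 1))
      ≤ ((F u - F (x n) - ⟪gradient F (x n), u - x n⟫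
          + α n * ⟪u, gradient g (x n)⟫
          + βs n * ⟪u, x (n - 1) - x n⟫ : ℝ) : EReal)
        + (α n : EReal) * f u)
    -- the parameters `μ, αlo, β` satisfy `μ(σ - Lg·αlo) > β(μ² + 1)` and `αhi` is chosen
    -- with `αlo < αhi` such that `M1 > M2`
    (μ : ℝ) (hμ : 0 < μ)
    (hcond : β * (μ ^ 2 + 1) < μ * (σ - Lg * αlo))
    (M1 M2 : ℝ)
    (hM1 : M1 = (σ - αhi * Lg) / (2 * αhi) - μ * β / (2 * αlo))
    (hM2 : M2 = β / (2 * μ * αlo))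
    (hαstrict : αlo < αhi) (hM : M2 < M1)

    -- `f + g` is coercive
    (hcoer : Tendsto (fun z => f z + ((g z : ℝ) : EReal))
      (comap (fun z : EuclideanSpace ℝ (Fin m) => ‖z‖) atTop) (𝓝 ⊤))
    :
    (∃ R : ℝ, ∀ n, ‖x n‖ ≤ R) ∧
    (∃ φ : ℕ → ℕ, StrictMono φ ∧ ∃ xb, Tendsto (fun k => x (φ k)) atTop (𝓝 xb) ∧
      (0 : EuclideanSpace ℝ (Fin m)) ∈ limitingSubdiff (fun z => f z + ((g z : ℝ) : EReal)) xb) ∧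
    (∀ z, MapClusterPt z atTop x →
      (0 : EuclideanSpace ℝ (Fin m)) ∈ limitingSubdiff (fun w => f w + ((g w : ℝ) : EReal)) z) := by
  obtain ⟨cl, hcl⟩ := hfbdd
  obtain ⟨B, hB⟩ := exists_lower_bound_of_coercive hcl hgdiff.continuous hcoer
  have hFc : Continuous (gradient F) :=
    (LipschitzWith.of_dist_le_mul (K := LF.toNNReal) fun z w => by
      simpa [dist_eq_norm, hLF.le] using hFlip z w).continuous
  have hgc : Continuous (gradient g) :=
    (LipschitzWith.of_dist_le_mul (K := Lg.toNNReal) fun z w => by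
      simpa [dist_eq_norm, hLg] using hglip z w).continuous
  have hαpos : ∀ n, 1 ≤ n → 0 < α n := fun n hn => hαlo.trans_le (hα n hn).1
  have hfin : ∀ n, 1 ≤ n → f (x (n + 1)) ≠ ⊤ := by
    intro n hn htop
    obtain ⟨u, hu⟩ := hfproper
    have h := halg n hn u
    lift f u to ℝ using ⟨hu, hfbot u⟩ with t
    rw [htop, EReal.coe_mul_top_of_pos (hαpos n hn), EReal.coe_add_top, top_le_iff,
      ← EReal.coe_mul, ← EReal.coe_add] at h
    exact EReal.coe_ne_top _ h
  set r : ℕ → ℝ := fun n => (f (x n)).toReal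
  have hr : ∀ n, 1 ≤ n → f (x (n + 1)) = (r (n + 1) : EReal) := fun n hn =>
    (EReal.coe_toReal (hfin n hn) (hfbot _)).symm
  have hmin : ∀ n, 1 ≤ n → ∀ (u : EuclideanSpace ℝ (Fin m)) (t : ℝ), f u = (t : EReal) →
      F (x (n + 1)) + ⟪α n • gradient g (x n) + βs n • (x (n - 1) - x n) - gradient F (x n),
          x (n + 1)⟫ + α n * r (n + 1)
        ≤ F u + ⟪α n • gradient g (x n) + βs n • (x (n - 1) - x n) - gradient F (x n), u⟫
          + α n * t := by
    intro n hn u t ht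
    have h := halg n hn u
    rw [hr n hn, ht, ← EReal.coe_mul, ← EReal.coe_mul, ← EReal.coe_add, ← EReal.coe_add,
      EReal.coe_le_coe_iff] at h
    simp only [inner_sub_left (_ + _), inner_add_left, inner_smul_left, RCLike.conj_to_real,
      inner_sub_right (gradient F (x n))] at h ⊢
    rw [real_inner_comm (gradient g (x n)) (x (n + 1)), real_inner_comm (gradient g (x n)) u,
      real_inner_comm (x (n - 1) - x n) (x (n + 1)), real_inner_comm (x (n - 1) - x n) u] at h
    linarith
  have hM2nn : 0 ≤ M2 := hM2 ▸ by positivity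
  have hdec : ∀ n, r (n + 2 + 1) + g (x (n + 2 + 1)) + M1 * ‖x (n + 2 + 1) - x (n + 1 + 1)‖ ^ 2
      ≤ r (n + 1 + 1) + g (x (n + 1 + 1)) + M2 * ‖x (n + 1 + 1) - x (n + 1)‖ ^ 2 := by
    intro n
    have hn : 1 ≤ n + 2 := by omega
    have h := hmin (n + 2) hn _ _ (hr (n + 1) (by omega))
    have hstrong := add_inner_gradient_add_sq_le_of_strongly_convex hFconv hFdiff
      (x (n + 2)) (x (n + 2 + 1))
    have hdesc := mul_le_mul_of_nonneg_left (le_add_inner_add_sq_of_lipschitz_gradient hgdiff hglip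
      (x (n + 2)) (x (n + 2 + 1))) (hαpos _ hn).le
    have hcs := mul_le_mul_of_nonneg_left (neg_le_of_abs_le
      (abs_real_inner_le_norm (x (n + 1) - x (n + 2)) (x (n + 2 + 1) - x (n + 2)))) (hβs _ hn).1
    rw [norm_sub_rev (x (n + 1))] at hcs
    subst hM1 hM2
    refine descent_step hαlo (hα _ hn).1 (hα _ hn).2 (hβs _ hn).2 hβ hσ hμ (norm_nonneg _)
      (norm_nonneg _) ?_
    simp only [inner_sub_left (_ + _), inner_add_left, inner_smul_left, RCLike.conj_to_real,
      inner_sub_right, show n + 2 - 1 = n + 1 from rfl,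
      show n + 1 + 1 = n + 2 from rfl] at h hstrong hdesc hcs ⊢
    linarith
  obtain ⟨hHle, hd⟩ := energy_bounded_and_tendsto_zero
    (H := fun n => r (n + 1 + 1) + g (x (n + 1 + 1)))
    (d := fun n => ‖x (n + 1 + 1) - x (n + 1)‖) (B := B) hM2nn hM (fun n => by
      have := hB (x (n + 1 + 1))
      rwa [hr _ (by omega), ← EReal.coe_add, EReal.coe_le_coe_iff] at this) hdec
  replace hd : Tendsto (fun n => ‖x (n + 1) - x n‖) atTop (𝓝 0) :=
    (tendsto_add_atTop_iff_nat 1).1 hd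
  set C := r (0 + 1 + 1) + g (x (0 + 1 + 1)) + M2 * ‖x (0 + 1 + 1) - x (0 + 1)‖ ^ 2
  have hbdd : ∃ R : ℝ, ∀ n, ‖x n‖ ≤ R := by
    obtain ⟨R, hR⟩ := exists_sublevel_subset_closedBall_of_coercive hcoer C
    refine ⟨max R (max ‖x 0‖ ‖x 1‖), fun n => ?_⟩
    match n with
    | 0 => simp
    | 1 => simp
    | n + 2 =>
      refine (hR _ ?_).trans (le_max_left _ _)
      rw [hr (n + 1) (by omega), ← EReal.coe_add, EReal.coe_le_coe_iff]
      exact hHle n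
  have hcrit : ∀ z, MapClusterPt z atTop x →
      (0 : EuclideanSpace ℝ (Fin m)) ∈ limitingSubdiff (fun w => f w + ((g w : ℝ) : EReal)) z := by
    intro z hz
    obtain ⟨φ, hφ, hφz⟩ := hz.tendsto_subseq
    obtain ⟨ν, hν⟩ : ∃ ν : ℕ → ℕ, ∀ k, φ (k + 2) = ν k + 1 + 1 :=
      ⟨fun k => φ (k + 2) - 2, fun k => by have := hφ.id_le (k + 2); simp only [id] at this ⊢; omega⟩
    have hνtop : Tendsto ν atTop atTop := by
      refine tendsto_atTop_mono (fun k => ?_) tendsto_id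
      have := hφ.id_le (k + 2)
      have := hν k
      simp only [id] at *
      omega
    have hx2 : Tendsto (fun k => x (ν k + 1 + 1)) atTop (𝓝 z) := by
      simpa [Function.comp_def, hν] using hφz.comp (tendsto_add_atTop_nat 2)
    have hd1 : Tendsto (fun k => ‖x (ν k + 1 + 1) - x (ν k + 1)‖) atTop (𝓝 0) :=
      hd.comp ((tendsto_add_atTop_nat 1).comp hνtop)
    have hd0 : Tendsto (fun k => ‖x (ν k) - x (ν k + 1)‖) atTop (𝓝 0) := by
      simpa [Function.comp_def, norm_sub_rev] using hd.comp hνtop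
    have hx1 : Tendsto (fun k => x (ν k + 1)) atTop (𝓝 z) := by
      simpa using hx2.sub (tendsto_zero_iff_norm_tendsto_zero.2 hd1)
    have hg2 : Tendsto (fun k => g (x (ν k + 1 + 1))) atTop (𝓝 (g z)) :=
      (hgdiff.continuous.tendsto z).comp hx2
    have hlower : ∀ c : ℝ, (c : EReal) < f z → ∀ᶠ k in atTop, c < r (ν k + 1 + 1) := by
      intro c hc
      filter_upwards [hx2.eventually (hflsc z c hc)] with k hk
      rwa [hr _ (by omega), gt_iff_lt, EReal.coe_lt_coe_iff] at hk
    have hfz : f z ≠ ⊤ := by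
      intro htop
      obtain ⟨k, hk1, hk2⟩ := ((hlower (C - g z + 1) (htop ▸ EReal.coe_lt_top _)).and
        (hg2.eventually (lt_mem_nhds (sub_one_lt (g z))))).exists
      have : r (ν k + 1 + 1) + g (x (ν k + 1 + 1)) ≤ C := hHle (ν k)
      linarith
    obtain ⟨t, ht⟩ : ∃ t : ℝ, f z = (t : EReal) :=
      ⟨_, (EReal.coe_toReal hfz (hfbot z)).symm⟩
    set c : ℕ → EuclideanSpace ℝ (Fin m) := fun k => α (ν k + 1) • gradient g (x (ν k + 1))
      + βs (ν k + 1) • (x (ν k) - x (ν k + 1)) - gradient F (x (ν k + 1)) with hcdef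
    have hck : ∀ k, ‖c k‖ ≤ αhi * ‖gradient g (x (ν k + 1))‖ + β * ‖x (ν k) - x (ν k + 1)‖
        + ‖gradient F (x (ν k + 1))‖ := by
      intro k
      have hk : 1 ≤ ν k + 1 := by omega
      refine (norm_sub_le _ _).trans (add_le_add_left ((norm_add_le _ _).trans ?_) _)
      rw [norm_smul, norm_smul, Real.norm_of_nonneg (hαpos _ hk).le,
        Real.norm_of_nonneg (hβs _ hk).1]
      gcongr
      exacts [(hα _ hk).2, (hβs _ hk).2]
    have hup : ∀ k, r (ν k + 1 + 1) ≤ t + (|F z - F (x (ν k + 1 + 1))|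
        + (αhi * ‖gradient g (x (ν k + 1))‖ + β * ‖x (ν k) - x (ν k + 1)‖
        + ‖gradient F (x (ν k + 1))‖) * ‖z - x (ν k + 1 + 1)‖) / αlo := by
      intro k
      have hk : 1 ≤ ν k + 1 := by omega
      have h := hmin _ hk z t ht
      have h1 := real_inner_le_norm (c k) (z - x (ν k + 1 + 1))
      have h2 := mul_le_mul_of_nonneg_right (hck k) (norm_nonneg (z - x (ν k + 1 + 1)))
      have h3 := le_abs_self (F z - F (x (ν k + 1 + 1)))
      rw [inner_sub_right] at h1
      rw [Nat.add_sub_cancel] at h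
      set e := |F z - F (x (ν k + 1 + 1))|
        + (αhi * ‖gradient g (x (ν k + 1))‖ + β * ‖x (ν k) - x (ν k + 1)‖
        + ‖gradient F (x (ν k + 1))‖) * ‖z - x (ν k + 1 + 1)‖ with he
      have he0 : 0 ≤ e := add_nonneg (abs_nonneg _)
        (mul_nonneg ((norm_nonneg _).trans (hck k)) (norm_nonneg _))
      have h4 : α (ν k + 1) * (r (ν k + 1 + 1) - t) ≤ e := by linarith
      have h5 : r (ν k + 1 + 1) - t ≤ e / α (ν k + 1) := by
        rwa [le_div_iff₀' (hαpos _ hk)]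
      have h6 : e / α (ν k + 1) ≤ e / αlo :=
        div_le_div_of_nonneg_left he0 hαlo (hα _ hk).1
      linarith
    have hup_lim : Tendsto (fun k => t + (|F z - F (x (ν k + 1 + 1))|
        + (αhi * ‖gradient g (x (ν k + 1))‖ + β * ‖x (ν k) - x (ν k + 1)‖
        + ‖gradient F (x (ν k + 1))‖) * ‖z - x (ν k + 1 + 1)‖) / αlo) atTop (𝓝 t) := by
      have l1 := (((hFdiff.continuous.tendsto z).comp hx2).const_sub (F z)).abs
      have l2 := (((hgc.tendsto z).comp hx1).norm.const_mul αhi).add (hd0.const_mul β)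
      have l3 := (l2.add ((hFc.tendsto z).comp hx1).norm).mul (hx2.const_sub z).norm
      simpa using ((l1.add l3).div_const αlo).const_add t
    have hrlim : Tendsto (fun k => r (ν k + 1 + 1)) atTop (𝓝 t) := by
      refine tendsto_order.2 ⟨fun a ha => hlower a (by rw [ht]; exact_mod_cast ha), fun a ha => ?_⟩
      filter_upwards [hup_lim.eventually (gt_mem_nhds ha)] with k hk
      exact (hup k).trans_lt hk
    refine ⟨?_, fun k => x (ν k + 1 + 1), fun k => gradient g (x (ν k + 1 + 1))
      - (α (ν k + 1))⁻¹ • (gradient F (x (ν k + 1 + 1)) + c k), hx2, ?_, fun k => ?_, ?_⟩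
    · simp only [ht, ← EReal.coe_add]
      exact EReal.coe_ne_top _
    · have hcongr : ∀ k, f (x (ν k + 1 + 1)) + ((g (x (ν k + 1 + 1)) : ℝ) : EReal)
          = ((r (ν k + 1 + 1) + g (x (ν k + 1 + 1)) : ℝ) : EReal) := fun k => by
        rw [hr _ (by omega), EReal.coe_add]
      simp only [hcongr, ht, ← EReal.coe_add]
      exact (continuous_coe_real_ereal.tendsto _).comp (hrlim.add hg2)
    · have hk : 1 ≤ ν k + 1 := by omega
      exact gradient_sub_mem_frechetSubdiff hfbot (hr _ hk) (hαpos _ hk) (hFdiff _) (hgdiff _)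
        (hmin _ hk)
    · have hbound : ∀ k, ‖gradient g (x (ν k + 1 + 1))
          - (α (ν k + 1))⁻¹ • (gradient F (x (ν k + 1 + 1)) + c k)‖
          ≤ Lg * ‖x (ν k + 1 + 1) - x (ν k + 1)‖
            + αlo⁻¹ * (LF * ‖x (ν k + 1 + 1) - x (ν k + 1)‖
              + β * ‖x (ν k) - x (ν k + 1)‖) := by
        intro k
        have hk : 1 ≤ ν k + 1 := by omega
        have e : gradient g (x (ν k + 1 + 1))
            - (α (ν k + 1))⁻¹ • (gradient F (x (ν k + 1 + 1)) + c k)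
            = (gradient g (x (ν k + 1 + 1)) - gradient g (x (ν k + 1)))
            - (α (ν k + 1))⁻¹ • ((gradient F (x (ν k + 1 + 1)) - gradient F (x (ν k + 1)))
              + βs (ν k + 1) • (x (ν k) - x (ν k + 1))) := by
          simp only [hcdef, smul_add, smul_sub, inv_smul_smul₀ (hαpos _ hk).ne']
          abel
        rw [e]
        refine (norm_sub_le _ _).trans (add_le_add (hglip _ _) ?_)
        rw [norm_smul, Real.norm_of_nonneg (inv_nonneg.2 (hαpos _ hk).le)]
        refine mul_le_mul (inv_anti₀ hαlo (hα _ hk).1) ((norm_add_le _ _).trans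
          (add_le_add (hFlip _ _) ?_)) (norm_nonneg _) (inv_nonneg.2 hαlo.le)
        rw [norm_smul, Real.norm_of_nonneg (hβs _ hk).1]
        exact mul_le_mul_of_nonneg_right (hβs _ hk).2 (norm_nonneg _)
      refine squeeze_zero_norm hbound ?_
      simpa using (hd1.const_mul Lg).add (((hd1.const_mul LF).add (hd0.const_mul β)).const_mul αlo⁻¹)
  refine ⟨hbdd, ?_, hcrit⟩
  obtain ⟨R, hR⟩ := hbdd
  obtain ⟨xb, -, φ, hφ, hlim⟩ := tendsto_subseq_of_bounded
    (Metric.isBounded_closedBall (x := (0 : EuclideanSpace ℝ (Fin m))) (r := R))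
    (fun n => by simpa using hR n)
  exact ⟨φ, hφ, xb, hlim, hcrit xb (MapClusterPt.of_comp hφ.tendsto_atTop hlim.mapClusterPt)⟩
end
end

section
/- In the setting of Problem 1, choose μ > 0, α̲ > 0 and β ≥ 0 satisfying μ(σ − L_{∇g}α̲) > β(μ² + 1), define M_1 = (σ − ᾱL_{∇g})/(2ᾱ) − μβ/(2α̲) and M_2 = β/(2μα̲), choose ᾱ > α̲ such that M_1 > M_2, assume f + g is coercive, and let (x_n)_{n∈ℕ} be a sequence generated by Algorithm 1. Define H : ℝ^m × ℝ^m → (−∞,+∞] by H(x,y) = (f+g)(x) + M_2‖x−y‖². Then H is finite and constant on the set ω((x_n, x_{n−1})_{n≥1}) of cluster points of (x_n, x_{n−1})_{n≥1}; more precisely, H(z) = lim_{n→+∞}(f+g)(x_n) for every z ∈ ω((x_n, x_{n−1})_{n≥1}). -/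
open Filter Topology RealInnerProductSpace

noncomputable section

variable {E : Type*} [NormedAddCommGroup E] [InnerProductSpace ℝ E]

theorem hasDerivAt_comp_add_smul [CompleteSpace E] {g : E → ℝ} (hg : Differentiable ℝ g)
    (z v : E) (t : ℝ) :
    HasDerivAt (fun t : ℝ => g (z + t • v)) ⟪gradient g (z + t • v), v⟫ t := by
  have hline : HasDerivAt (fun t : ℝ => z + t • v) v t := by
    simpa using ((hasDerivAt_id t).smul_const v).const_add z
  exact (hg (z + t • v)).hasGradientAt.hasFDerivAt.comp_hasDerivAt t hline

theorem continuous_gradient_of_norm_sub_le [CompleteSpace E] {g : E → ℝ} {L : ℝ}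
    (hlip : ∀ z w, ‖gradient g z - gradient g w‖ ≤ L * ‖z - w‖) : Continuous (gradient g) :=
  (LipschitzWith.of_dist_le' (K := L) fun z w => by
    simpa only [dist_eq_norm] using hlip z w).continuous

/-- The descent lemma for functions with Lipschitz gradient. -/
theorem le_add_inner_gradient_add_sq [CompleteSpace E] {g : E → ℝ} {L : ℝ}
    (hg : Differentiable ℝ g)
    (hlip : ∀ z w, ‖gradient g z - gradient g w‖ ≤ L * ‖z - w‖) (z w : E) :
    g w ≤ g z + ⟪gradient g z, w - z⟫ + L / 2 * ‖w - z‖ ^ 2 := by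
  set v := w - z with hv
  let k : ℝ → ℝ := fun t => g (z + t • v) - (t * ⟪gradient g z, v⟫ + L / 2 * ‖v‖ ^ 2 * t ^ 2)
  have hk : ∀ t, HasDerivAt k (⟪gradient g (z + t • v), v⟫
      - (⟪gradient g z, v⟫ + L / 2 * ‖v‖ ^ 2 * (2 * t))) t := fun t => by
    refine (hasDerivAt_comp_add_smul hg z v t).sub (HasDerivAt.add ?_ ?_)
    · simpa using (hasDerivAt_id t).mul_const ⟪gradient g z, v⟫
    · simpa using (hasDerivAt_pow 2 t).const_mul (L / 2 * ‖v‖ ^ 2)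
  have hanti : AntitoneOn k (Set.Icc 0 1) := by
    refine antitoneOn_of_deriv_nonpos (convex_Icc 0 1)
      (fun t _ => (hk t).continuousAt.continuousWithinAt)
      (fun t _ => (hk t).differentiableAt.differentiableWithinAt) fun t ht => ?_
    rw [interior_Icc] at ht
    rw [(hk t).deriv]
    have h1 : ⟪gradient g (z + t • v) - gradient g z, v⟫ ≤ L * (t * ‖v‖) * ‖v‖ := by
      refine (real_inner_le_norm _ _).trans (mul_le_mul_of_nonneg_right ?_ (norm_nonneg v))
      simpa [norm_smul, abs_of_pos ht.1] using hlip (z + t • v) z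
    rw [inner_sub_left] at h1
    linarith
  have h := hanti (Set.left_mem_Icc.2 zero_le_one) (Set.right_mem_Icc.2 zero_le_one) zero_le_one
  simp only [k, one_smul, zero_smul, add_zero, hv, add_sub_cancel] at h
  linarith

/-- The first-order lower bound for differentiable strongly convex functions. -/
theorem add_inner_gradient_add_sq_le [CompleteSpace E] {F : E → ℝ} {σ : ℝ}
    (hF : ConvexOn ℝ Set.univ fun z => F z - σ / 2 * ‖z‖ ^ 2) (hdiff : Differentiable ℝ F)
    (z w : E) :
    F z + ⟪gradient F z, w - z⟫ + σ / 2 * ‖w - z‖ ^ 2 ≤ F w := by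
  set v := w - z with hv
  have hw : w = z + v := by simp [hv]
  have hconv : ConvexOn ℝ Set.univ fun t : ℝ => F (z + t • v) - σ / 2 * ‖z + t • v‖ ^ 2 := by
    have := hF.comp_affineMap (AffineMap.lineMap (k := ℝ) z w)
    simpa [Function.comp_def, AffineMap.lineMap_apply, ← hv, add_comm] using this
  have hsq : HasDerivAt (fun t : ℝ => ‖z + t • v‖ ^ 2) (2 * ⟪z + (0 : ℝ) • v, v⟫) 0 := by
    have hline : HasDerivAt (fun t : ℝ => z + t • v) v 0 := by
      simpa using ((hasDerivAt_id (0 : ℝ)).smul_const v).const_add z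
    exact hline.norm_sq
  have h := hconv.le_slope_of_hasDerivAt (Set.mem_univ 0) (Set.mem_univ 1) one_pos
    ((hasDerivAt_comp_add_smul hdiff z v 0).sub (hsq.const_mul (σ / 2)))
  simp only [slope_def_field, one_smul, zero_smul, add_zero, sub_zero, div_one] at h
  rw [hw]
  have := norm_add_sq_real z v
  rw [this] at h
  linarith

/-- If the sum of a function bounded below and a continuous real function is coercive, then it
is bounded below. -/
theorem exists_real_le_of_coercive {X : Type*} [NormedAddCommGroup X] [ProperSpace X]
    {f : X → EReal} {g : X → ℝ}
    (hf : ∃ c : ℝ, ∀ z, (c : EReal) ≤ f z) (hg : Continuous g)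
    (hcoer : Tendsto (fun z => f z + ((g z : ℝ) : EReal)) (comap (fun z : X => ‖z‖) atTop) (𝓝 ⊤)) :
    ∃ c : ℝ, ∀ z, (c : EReal) ≤ f z + ((g z : ℝ) : EReal) := by
  obtain ⟨c, hc⟩ := hf
  obtain ⟨R, hR⟩ := eventually_atTop.1
    (eventually_comap.1 (hcoer.eventually (eventually_gt_nhds (EReal.coe_lt_top 0))))
  obtain ⟨b, hb⟩ := (isCompact_closedBall (0 : X) R).bddBelow_image hg.continuousOn
  refine ⟨min 0 (c + b), fun z => ?_⟩
  rcases le_total R ‖z‖ with h | h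
  · exact (EReal.coe_le_coe_iff.2 (min_le_left _ _)).trans (hR _ h z rfl).le
  · refine (EReal.coe_le_coe_iff.2 (min_le_right _ _)).trans ?_
    rw [EReal.coe_add]
    exact add_le_add (hc z) (EReal.coe_le_coe_iff.2
      (hb (Set.mem_image_of_mem g (mem_closedBall_zero_iff.2 h))))

theorem EReal.toReal_le_of_add_mul_le {a b A : ℝ} {p q : EReal} (hA : 0 < A) (hp : p ≠ ⊥)
    (hq : q ≠ ⊥) (hq' : q ≠ ⊤) (h : (a : EReal) + A * p ≤ b + A * q) :
    p ≠ ⊤ ∧ a + A * p.toReal ≤ b + A * q.toReal := by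
  lift q to ℝ using ⟨hq', hq⟩
  have hp' : p ≠ ⊤ := by
    rintro rfl
    rw [EReal.coe_mul_top_of_pos hA, EReal.coe_add_top, ← EReal.coe_mul, ← EReal.coe_add] at h
    exact EReal.coe_ne_top _ (top_le_iff.1 h)
  lift p to ℝ using ⟨hp', hp⟩
  exact ⟨hp', by exact_mod_cast h⟩

theorem exists_tendsto_of_add_sq_le {s d : ℕ → ℝ} {M₁ M₂ c : ℝ} (hM : M₂ < M₁) (hM₂ : 0 ≤ M₂)
    (hs : ∀ n, c ≤ s n) (h : ∀ n, s (n + 1) + M₁ * d (n + 1) ^ 2 ≤ s n + M₂ * d n ^ 2) :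
    ∃ l, Tendsto s atTop (𝓝 l) ∧ Tendsto d atTop (𝓝 0) := by
  let V : ℕ → ℝ := fun n => s n + M₂ * d n ^ 2
  have hstep : ∀ n, V (n + 1) + (M₁ - M₂) * d (n + 1) ^ 2 ≤ V n := fun n => by
    have := h n
    simp only [V]
    linarith
  have hanti : Antitone V := antitone_nat_of_succ_le fun n => by
    have := hstep n
    have := mul_nonneg (sub_nonneg.2 hM.le) (sq_nonneg (d (n + 1)))
    linarith
  have hV := tendsto_atTop_ciInf hanti ⟨c, by
    rintro _ ⟨n, rfl⟩
    have := mul_nonneg hM₂ (sq_nonneg (d n))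
    exact (hs n).trans (le_add_of_nonneg_right this)⟩
  have hd2 : Tendsto (fun n => d n ^ 2) atTop (𝓝 0) := by
    rw [← tendsto_add_atTop_iff_nat 1]
    have hdiff : Tendsto (fun n => (V n - V (n + 1)) / (M₁ - M₂)) atTop (𝓝 0) := by
      simpa using (hV.sub ((tendsto_add_atTop_iff_nat 1).2 hV)).div_const (M₁ - M₂)
    refine squeeze_zero (fun n => sq_nonneg _) (fun n => ?_) hdiff
    rw [le_div_iff₀ (sub_pos.2 hM)]
    linarith [hstep n]
  refine ⟨_, by simpa [V] using hV.sub (hd2.const_mul M₂), ?_⟩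
  have := hd2.sqrt
  simp only [Real.sqrt_sq_eq_abs, Real.sqrt_zero] at this
  exact (tendsto_zero_iff_abs_tendsto_zero d).2 this

/-- The estimate behind the sufficient decrease property: a Bregman proximal step with
inertia `b`, tested against the previous point. -/
theorem sufficient_decrease_of_le {D p δ d d' s s' A b σ L αlo αhi β μ : ℝ}
    (hαlo : 0 < αlo) (hA : αlo ≤ A) (hA' : A ≤ αhi) (hσ : 0 < σ) (hβ : 0 ≤ β) (hμ : 0 < μ)
    (hb : 0 ≤ b) (hb' : b ≤ β) (hD : σ / 2 * d' ^ 2 ≤ D) (hp : |p| ≤ d' * d)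
    (hs : s' - s ≤ δ + L / 2 * d' ^ 2) (h : D + A * δ + b * p ≤ 0) :
    s' + ((σ - αhi * L) / (2 * αhi) - μ * β / (2 * αlo)) * d' ^ 2
      ≤ s + β / (2 * μ * αlo) * d ^ 2 := by
  have hA0 : 0 < A := hαlo.trans_le hA
  have hαhi : 0 < αhi := hA0.trans_le hA'
  have hyoung : |p| ≤ μ / 2 * d' ^ 2 + 1 / (2 * μ) * d ^ 2 := by
    refine hp.trans ?_
    have : μ / 2 * d' ^ 2 + 1 / (2 * μ) * d ^ 2 - d' * d = (μ * d' - d) ^ 2 / (2 * μ) := by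
      field_simp
      ring
    have h0 : 0 ≤ (μ * d' - d) ^ 2 / (2 * μ) := by positivity
    linarith
  have hbA : b / A ≤ β / αlo := div_le_div₀ hβ hb' hαlo hA
  have hσA : σ / αhi ≤ σ / A := div_le_div_of_nonneg_left hσ.le hA0 hA'
  have hδ : δ ≤ -(σ / A / 2 * d' ^ 2) + b / A * |p| := by
    have h1 : A * δ ≤ -(σ / 2 * d' ^ 2) + b * |p| := by
      nlinarith [neg_abs_le p]
    have h2 : δ ≤ (-(σ / 2 * d' ^ 2) + b * |p|) / A := by
      rw [le_div_iff₀ hA0]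
      linarith
    refine h2.trans_eq ?_
    field_simp
  have h3 : b / A * |p| ≤ β / αlo * (μ / 2 * d' ^ 2 + 1 / (2 * μ) * d ^ 2) :=
    mul_le_mul hbA hyoung (abs_nonneg p) (by positivity)
  have h4 : σ / αhi / 2 * d' ^ 2 ≤ σ / A / 2 * d' ^ 2 := by gcongr
  have e : s + β / (2 * μ * αlo) * d ^ 2
      - (s' + ((σ - αhi * L) / (2 * αhi) - μ * β / (2 * αlo)) * d' ^ 2)
      = s - s' - σ / αhi / 2 * d' ^ 2 + L / 2 * d' ^ 2
        + β / αlo * (μ / 2 * d' ^ 2 + 1 / (2 * μ) * d ^ 2) := by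
    field_simp
    ring
  linarith

/-- Lemma 3.6(d): `H` is finite and constant on the set of cluster points of
`(x_n, x_{n-1})_{n ≥ 1}`; its value there is `lim (f+g)(x_n)`. -/
theorem stmt14
    (m : ℕ)
    (f : EuclideanSpace ℝ (Fin m) → EReal)
    -- `f` is proper (never `⊥`, somewhere finite), lower semicontinuous and bounded below
    (hfbot : ∀ z, f z ≠ ⊥) (hfproper : ∃ z, f z ≠ ⊤)
    (hflsc : LowerSemicontinuous f)
    (hfbdd : ∃ cl : ℝ, ∀ z, (cl : EReal) ≤ f z)
    -- `g` is differentiable with `Lg`-Lipschitz gradient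
    (g : EuclideanSpace ℝ (Fin m) → ℝ) (Lg : ℝ) (hLg : 0 ≤ Lg)
    (hgdiff : Differentiable ℝ g)
    (hglip : ∀ z w, ‖gradient g z - gradient g w‖ ≤ Lg * ‖z - w‖)
    -- `F` is `σ`-strongly convex and differentiable with `LF`-Lipschitz gradient
    (F : EuclideanSpace ℝ (Fin m) → ℝ) (σ LF : ℝ) (hσ : 0 < σ) (hLF : 0 < LF)
    (hFconv : ConvexOn ℝ Set.univ fun z => F z - σ / 2 * ‖z‖ ^ 2)
    (hFdiff : Differentiable ℝ F)
    (hFlip : ∀ z w, ‖gradient F z - gradient F w‖ ≤ LF * ‖z - w‖)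
    -- parameters of the algorithm
    (αlo αhi β : ℝ) (hαlo : 0 < αlo) (hαorder : αlo ≤ αhi) (hβ : 0 ≤ β)
    (α βs : ℕ → ℝ)
    (hα : ∀ n, 1 ≤ n → αlo ≤ α n ∧ α n ≤ αhi)
    (hβs : ∀ n, 1 ≤ n → 0 ≤ βs n ∧ βs n ≤ β)
    -- the sequence generated by Algorithm 1:
    -- `x (n+1)` minimizes `u ↦ D_F(u, x n) + α n • ⟪u, ∇g(x n)⟫ + βs n • ⟪u, x (n-1) - x n⟫ + α n • f u`
    (x : ℕ → EuclideanSpace ℝ (Fin m))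
    (halg : ∀ n, 1 ≤ n → ∀ u,
      ((F (x (n + 1)) - F (x n) - ⟪gradient F (x n), x (n + 1) - x n⟫
          + α n * ⟪x (n + 1), gradient g (x n)⟫
          + βs n * ⟪x (n + 1), x (n - 1) - x n⟫ : ℝ) : EReal)
        + (α n : EReal) * f (x (n + 1))
      ≤ ((F u - F (x n) - ⟪gradient F (x n), u - x n⟫
          + α n * ⟪u, gradient g (x n)⟫
          + βs n * ⟪u, x (n - 1) - x n⟫ : ℝ) : EReal)
        + (α n : EReal) * f u)
    -- the parameters `μ, αlo, β` satisfy `μ(σ - Lg·αlo) > β(μ² + 1)` and `αhi` is chosen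
    -- with `αlo < αhi` such that `M1 > M2`
    (μ : ℝ) (hμ : 0 < μ)
    (hcond : β * (μ ^ 2 + 1) < μ * (σ - Lg * αlo))
    (M1 M2 : ℝ)
    (hM1 : M1 = (σ - αhi * Lg) / (2 * αhi) - μ * β / (2 * αlo))
    (hM2 : M2 = β / (2 * μ * αlo))
    (hαstrict : αlo < αhi) (hM : M2 < M1)

    -- `f + g` is coercive
    (hcoer : Tendsto (fun z => f z + ((g z : ℝ) : EReal))
      (comap (fun z : EuclideanSpace ℝ (Fin m) => ‖z‖) atTop) (𝓝 ⊤))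

    -- `H(x, y) = (f+g)(x) + M2‖x - y‖²` on the Euclidean product space
    (H : WithLp 2 (EuclideanSpace ℝ (Fin m) × EuclideanSpace ℝ (Fin m)) → EReal)
    (hH : ∀ p, H p = f (WithLp.equiv 2 _ p).1
      + ((g (WithLp.equiv 2 _ p).1 + M2 * ‖(WithLp.equiv 2 _ p).1 - (WithLp.equiv 2 _ p).2‖ ^ 2 : ℝ) : EReal))
    :
    ∃ l : ℝ,
      Tendsto (fun n => f (x n) + ((g (x n) : ℝ) : EReal)) atTop (𝓝 (l : EReal)) ∧
      ∀ p, MapClusterPt p atTop (fun n => (WithLp.equiv 2 _).symm (x (n + 1), x n)) →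
        H p = (l : EReal) := by
  obtain ⟨z₀, hz₀⟩ := hfproper
  have hαpos : ∀ n, 1 ≤ n → 0 < α n := fun n hn => hαlo.trans_le (hα n hn).1
  have hfin : ∀ n, f (x (n + 2)) ≠ ⊤ := fun n =>
    (EReal.toReal_le_of_add_mul_le (hαpos (n + 1) (by omega)) (hfbot _) (hfbot z₀) hz₀
      (halg (n + 1) (by omega) z₀)).1
  have hcoe : ∀ n, ((f (x (n + 2))).toReal : EReal) = f (x (n + 2)) := fun n =>
    EReal.coe_toReal (hfin n) (hfbot _)
  obtain ⟨c, hc⟩ := exists_real_le_of_coercive hfbdd hgdiff.continuous hcoer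
  let s : ℕ → ℝ := fun n => (f (x (n + 2))).toReal + g (x (n + 2))
  have hs : ∀ n, ((s n : ℝ) : EReal) = f (x (n + 2)) + ((g (x (n + 2)) : ℝ) : EReal) :=
    fun n => by rw [EReal.coe_add, hcoe]
  have hM2nonneg : 0 ≤ M2 := by rw [hM2]; positivity
  obtain ⟨l, hl, hd⟩ := exists_tendsto_of_add_sq_le (s := s)
    (d := fun n => ‖x (n + 2) - x (n + 1)‖) (c := c) hM hM2nonneg
    (fun n => EReal.coe_le_coe_iff.1 (by rw [hs]; exact hc _)) fun n => by
      have hstep := (EReal.toReal_le_of_add_mul_le (hαpos (n + 2) (by omega)) (hfbot _) (hfbot _)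
        (hfin n) (halg (n + 2) (by omega) (x (n + 2)))).2
      rw [hM1, hM2]
      refine sufficient_decrease_of_le (A := α (n + 2)) (b := βs (n + 2))
        (D := F (x (n + 3)) - F (x (n + 2)) - ⟪gradient F (x (n + 2)), x (n + 3) - x (n + 2)⟫)
        (p := ⟪x (n + 3) - x (n + 2), x (n + 1) - x (n + 2)⟫)
        (δ := (f (x (n + 3))).toReal - (f (x (n + 2))).toReal
          + ⟪gradient g (x (n + 2)), x (n + 3) - x (n + 2)⟫)
        hαlo (hα _ (by omega)).1 (hα _ (by omega)).2 hσ hβ hμ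
        (hβs _ (by omega)).1 (hβs _ (by omega)).2 ?_ ?_ ?_ ?_
      · have := add_inner_gradient_add_sq_le hFconv hFdiff (x (n + 2)) (x (n + 3))
        linarith
      · refine (abs_real_inner_le_norm _ _).trans_eq ?_
        rw [norm_sub_rev (x (n + 1))]
      · have := le_add_inner_gradient_add_sq hgdiff hglip (x (n + 2)) (x (n + 3))
        simp only [s]
        linarith
      · simp only [sub_self, inner_zero_right, show n + 2 + 1 = n + 3 from rfl,
          show n + 2 - 1 = n + 1 from rfl] at hstep
        rw [real_inner_comm (x (n + 3) - x (n + 2)) (gradient g (x (n + 2))),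
          inner_sub_left (x (n + 3)), inner_sub_left (x (n + 3))]
        linarith
  refine ⟨l, ?_, fun p hp => ?_⟩
  · rw [← tendsto_add_atTop_iff_nat 2]
    simpa only [← hs] using EReal.tendsto_coe.2 hl
  obtain ⟨U, hU, hUp⟩ := mapClusterPt_iff_ultrafilter.1 hp
  have hU1 : Tendsto (fun n => x (n + 1)) U (𝓝 p.fst) :=
    ((WithLp.prod_continuous_ofLp 2 _ _).fst.tendsto p).comp hUp
  have hU0 : Tendsto x U (𝓝 p.snd) :=
    ((WithLp.prod_continuous_ofLp 2 _ _).snd.tendsto p).comp hUp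
  have hd1 : Tendsto (fun n => x (n + 1) - x n) atTop (𝓝 0) := by
    rw [← tendsto_add_atTop_iff_nat 1]
    exact tendsto_zero_iff_norm_tendsto_zero.2 hd
  have hdpred : Tendsto (fun n => x (n - 1) - x n) atTop (𝓝 0) := by
    rw [← tendsto_add_atTop_iff_nat 1]
    simpa using hd1.neg
  have hdiag : p.fst = p.snd :=
    sub_eq_zero.1 (tendsto_nhds_unique (hU1.sub hU0) (hd1.mono_left hU))
  rw [← hdiag] at hU0
  set a := p.fst
  have hφ : Tendsto (fun n => (f (x (n + 1))).toReal) U (𝓝 (l - g a)) := by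
    have hl' : Tendsto (fun n => (f (x (n + 1))).toReal + g (x (n + 1))) atTop (𝓝 l) :=
      (tendsto_add_atTop_iff_nat 1).1 hl
    simpa using (hl'.mono_left hU).sub ((hgdiff.continuous.tendsto a).comp hU1)
  have hge : ∀ᶠ n in (U : Filter ℕ), 1 ≤ n := hU (eventually_ge_atTop 1)
  have hfa : f a ≤ ((l - g a : ℝ) : EReal) := by
    by_contra! hlt
    obtain ⟨r, hr, hr'⟩ := EReal.lt_iff_exists_real_btwn.1 hlt
    have h1 : ∀ᶠ n in (U : Filter ℕ), (r : EReal) < f (x (n + 1)) :=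
      hU1.eventually (hflsc a r hr')
    have h2 := hφ.eventually (eventually_lt_nhds (EReal.coe_lt_coe_iff.1 hr))
    obtain ⟨n, hn, hn', hn1⟩ := (h1.and (h2.and hge)).exists
    obtain ⟨k, rfl⟩ := Nat.exists_eq_add_of_le' hn1
    rw [← hcoe k] at hn
    exact lt_asymm (EReal.coe_lt_coe_iff.1 hn) hn'
  have hfa' : f a ≠ ⊤ := (hfa.trans_lt (EReal.coe_lt_top _)).ne
  have hle : l - g a ≤ (f a).toReal := by
    have hinner : Tendsto (fun n => a - x (n + 1)) U (𝓝 0) := by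
      simpa using hU1.const_sub a
    have hB : Tendsto (fun n => F a - F (x (n + 1)) - ⟪gradient F (x n), a - x (n + 1)⟫)
        U (𝓝 0) := by
      simpa using (((hFdiff.continuous.tendsto a).comp hU1).const_sub (F a)).sub
        ((((continuous_gradient_of_norm_sub_le hFlip).tendsto a).comp hU0).inner (𝕜 := ℝ) hinner)
    have hG : Tendsto (fun n => ⟪a - x (n + 1), gradient g (x n)⟫) U (𝓝 0) := by
      simpa using hinner.inner (𝕜 := ℝ)
        (((continuous_gradient_of_norm_sub_le hglip).tendsto a).comp hU0)
    have hI : Tendsto (fun n => ⟪a - x (n + 1), x (n - 1) - x n⟫) U (𝓝 0) := by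
      simpa using hinner.inner (𝕜 := ℝ) (hdpred.mono_left hU)
    have hlim : Tendsto (fun n => (f a).toReal
        + |F a - F (x (n + 1)) - ⟪gradient F (x n), a - x (n + 1)⟫| / αlo
        + ⟪a - x (n + 1), gradient g (x n)⟫
        + β / αlo * |⟪a - x (n + 1), x (n - 1) - x n⟫|) U (𝓝 (f a).toReal) := by
      simpa using (((hB.abs.div_const αlo).const_add (f a).toReal).add hG).add
        (hI.abs.const_mul (β / αlo))
    refine le_of_tendsto_of_tendsto hφ hlim ?_
    filter_upwards [hge] with n hn
    have hstep := (EReal.toReal_le_of_add_mul_le (hαpos n hn) (hfbot _) (hfbot a) hfa'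
      (halg n hn a)).2
    set B := F a - F (x (n + 1)) - ⟪gradient F (x n), a - x (n + 1)⟫ with hBdef
    set I := ⟪a - x (n + 1), x (n - 1) - x n⟫ with hIdef
    have hαn := hαpos n hn
    have h1 : α n * ((f (x (n + 1))).toReal - (f a).toReal - ⟪a - x (n + 1), gradient g (x n)⟫)
        ≤ |B| + βs n * |I| := by
      have hI' := mul_le_mul_of_nonneg_left (le_abs_self I) (hβs n hn).1
      have hB' := le_abs_self B
      refine le_trans ?_ (add_le_add hB' hI')
      simp only [hBdef, hIdef, inner_sub_left, inner_sub_right] at hstep ⊢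
      linarith
    have h2 : (f (x (n + 1))).toReal - (f a).toReal - ⟪a - x (n + 1), gradient g (x n)⟫
        ≤ |B| / α n + βs n / α n * |I| := by
      rw [div_mul_eq_mul_div, ← add_div, le_div_iff₀ hαn]
      linarith
    have h3 : |B| / α n ≤ |B| / αlo :=
      div_le_div_of_nonneg_left (abs_nonneg B) hαlo (hα n hn).1
    have h4 : βs n / α n * |I| ≤ β / αlo * |I| :=
      mul_le_mul_of_nonneg_right (div_le_div₀ hβ (hβs n hn).2 hαlo (hα n hn).1) (abs_nonneg I)
    linarith
  have hfeq : f a = ((l - g a : ℝ) : EReal) := by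
    refine le_antisymm hfa ?_
    rw [← EReal.coe_toReal hfa' (hfbot a)]
    exact EReal.coe_le_coe_iff.2 hle
  have hHp : H p = f a + ((g a + M2 * ‖a - p.snd‖ ^ 2 : ℝ) : EReal) := hH p
  rw [hHp, ← hdiag, hfeq, ← EReal.coe_add]
  simp
end
end

section
/- In the setting of Problem 1, choose μ > 0, α̲ > 0 and β ≥ 0 satisfying μ(σ − L_{∇g}α̲) > β(μ² + 1), define M_1 = (σ − ᾱL_{∇g})/(2ᾱ) − μβ/(2α̲) and M_2 = β/(2μα̲), choose ᾱ > α̲ such that M_1 > M_2, and assume f + g is coercive. Define H : ℝ^m × ℝ^m → (−∞,+∞] by H(x,y) = (f+g)(x) + M_2‖x−y‖², and assume H is a KL function. Let (x_n)_{n∈ℕ} be a sequence generated by Algorithm 1. Then ∑_{n∈ℕ} ‖x_{n+1} − x_n‖ < +∞, and there exists a critical point x of f + g such that x_n → x as n → +∞. -/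
open Filter Topology RealInnerProductSpace

noncomputable section

variable {E : Type*} [NormedAddCommGroup E] [InnerProductSpace ℝ E]

/-- The Kurdyka–Łojasiewicz property of `h` at a point `xb` with nonempty limiting
subdifferential. -/
def KLAt (h : E → EReal) (xb : E) : Prop :=
  ∃ η : EReal, 0 < η ∧ ∃ U ∈ 𝓝 xb, ∃ φ φ' : ℝ → ℝ,
    φ 0 = 0 ∧
    ConcaveOn ℝ {s : ℝ | 0 ≤ s ∧ (s : EReal) < η} φ ∧
    ContinuousOn φ {s : ℝ | 0 ≤ s ∧ (s : EReal) < η} ∧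
    (∀ s : ℝ, 0 < s → (s : EReal) < η → HasDerivAt φ (φ' s) s) ∧
    ContinuousOn φ' {s : ℝ | 0 < s ∧ (s : EReal) < η} ∧
    (∀ s : ℝ, 0 < s → (s : EReal) < η → 0 < φ' s) ∧
    ∀ z ∈ U, h xb < h z → h z < h xb + η →
      1 ≤ ENNReal.ofReal (φ' ((h z - h xb).toReal)) *
        EMetric.infEdist (0 : E) (limitingSubdiff h z)

/-- `h` is a KL function if it has the KL property at every point of the domain of its
limiting subdifferential. -/
def KLFunction (h : E → EReal) : Prop :=
  ∀ xb : E, (limitingSubdiff h xb).Nonempty → KLAt h xb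

/-- The derivative of a differentiable function along a segment. -/
lemma hasDerivAt_comp_segment [CompleteSpace E] {G : E → ℝ} {q x u : E} {t : ℝ}
    (hG : HasGradientAt G q (x + t • (u - x))) :
    HasDerivAt (fun s : ℝ => G (x + s • (u - x))) ⟪q, u - x⟫ t := by
  have h1 : HasDerivAt (fun s : ℝ => x + s • (u - x)) (u - x) t := by
    simpa using ((hasDerivAt_id t).smul_const (u - x)).const_add x
  exact hG.hasFDerivAt.comp_hasDerivAt t h1

/-- The gradient inequality for a convex function. -/
lemma ConvexOn.add_inner_le_of_hasGradientAt [CompleteSpace E] {G : E → ℝ} {q x : E}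
    (hc : ConvexOn ℝ Set.univ G) (hG : HasGradientAt G q x) (u : E) :
    G x + ⟪q, u - x⟫ ≤ G u := by
  have hd : HasDerivAt (fun s : ℝ => G (x + s • (u - x))) ⟪q, u - x⟫ 0 :=
    hasDerivAt_comp_segment (by simpa using hG)
  have hconv : ConvexOn ℝ Set.univ (fun s : ℝ => G (x + s • (u - x))) := by
    have := hc.comp_affineMap (AffineMap.lineMap x u : ℝ →ᵃ[ℝ] E)
    simpa [Function.comp_def, AffineMap.lineMap_apply, add_comm] using this
  have := hconv.le_slope_of_hasDerivAt (Set.mem_univ 0) (Set.mem_univ 1) one_pos hd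
  simp [slope_def_field] at this
  linarith

/-- A `σ`-strongly convex function has Bregman distance at least `σ / 2 * ‖u - x‖ ^ 2`. -/
lemma bregman_ge_of_strongConvex [CompleteSpace E] {F : E → ℝ} {σ : ℝ}
    (hF : ConvexOn ℝ Set.univ fun z => F z - σ / 2 * ‖z‖ ^ 2) (hd : Differentiable ℝ F)
    (x u : E) :
    σ / 2 * ‖u - x‖ ^ 2 ≤ F u - F x - ⟪gradient F x, u - x⟫ := by
  have hn : HasGradientAt (fun z : E => σ / 2 * ‖z‖ ^ 2) (σ • x) x := by
    rw [hasGradientAt_iff_hasFDerivAt]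
    refine ((hasStrictFDerivAt_norm_sq x).hasFDerivAt.const_mul (σ / 2)).congr_fderiv ?_
    ext y
    simp
    ring
  have hG : HasGradientAt (fun z => F z - σ / 2 * ‖z‖ ^ 2) (gradient F x - σ • x) x := by
    rw [hasGradientAt_iff_hasFDerivAt, map_sub]
    exact (hd x).hasGradientAt.hasFDerivAt.sub hn.hasFDerivAt
  have h := hF.add_inner_le_of_hasGradientAt hG u
  have e1 : ‖u - x‖ ^ 2 = ‖u‖ ^ 2 - 2 * ⟪x, u⟫ + ‖x‖ ^ 2 := by
    rw [norm_sub_sq_real, real_inner_comm]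
  simp only [inner_sub_left, inner_sub_right, real_inner_smul_left,
    real_inner_self_eq_norm_sq] at h ⊢
  rw [e1]
  linarith

/-- The descent lemma for a function with Lipschitz gradient. -/
lemma le_add_inner_of_lipschitz_gradient [CompleteSpace E] {g : E → ℝ} {L : ℝ}
    (hd : Differentiable ℝ g) (hL : ∀ z w, ‖gradient g z - gradient g w‖ ≤ L * ‖z - w‖)
    (x u : E) :
    g u ≤ g x + ⟪gradient g x, u - x⟫ + L / 2 * ‖u - x‖ ^ 2 := by
  set ψ : ℝ → ℝ := fun t =>
    g (x + t • (u - x)) - t * ⟪gradient g x, u - x⟫ - L / 2 * ‖u - x‖ ^ 2 * t ^ 2 with hψ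
  have hder : ∀ t, HasDerivAt ψ (⟪gradient g (x + t • (u - x)), u - x⟫ -
      ⟪gradient g x, u - x⟫ - L / 2 * ‖u - x‖ ^ 2 * (2 * t)) t := by
    intro t
    have h1 := hasDerivAt_comp_segment (hd (x + t • (u - x))).hasGradientAt
    have h2 := (hasDerivAt_id t).mul_const ⟪gradient g x, u - x⟫
    have h3 := (hasDerivAt_pow 2 t).const_mul (L / 2 * ‖u - x‖ ^ 2)
    exact ((h1.sub h2).sub h3).congr_deriv (by simp)
  have hanti : AntitoneOn ψ (Set.Icc 0 1) := by
    refine antitoneOn_of_deriv_nonpos (convex_Icc 0 1)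
      (fun t _ => (hder t).continuousAt.continuousWithinAt)
      (fun t _ => (hder t).differentiableAt.differentiableWithinAt) fun t ht => ?_
    rw [interior_Icc] at ht
    rw [(hder t).deriv, ← inner_sub_left]
    have h1 := real_inner_le_norm (gradient g (x + t • (u - x)) - gradient g x) (u - x)
    have h2 := hL (x + t • (u - x)) x
    rw [add_sub_cancel_left, norm_smul, Real.norm_of_nonneg ht.1.le] at h2
    nlinarith [norm_nonneg (u - x)]
  have := hanti (Set.left_mem_Icc.2 zero_le_one) (Set.right_mem_Icc.2 zero_le_one) zero_le_one
  simp only [hψ, one_smul, zero_smul, add_sub_cancel, add_zero] at this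
  linarith

/-- The tangent inequality for a concave function on an interval of `ℝ`. -/
lemma ConcaveOn.le_add_mul_of_hasDerivAt {S : Set ℝ} {φ : ℝ → ℝ} {p s t : ℝ}
    (hφ : ConcaveOn ℝ S φ) (hs : s ∈ S) (ht : t ∈ S) (hd : HasDerivAt φ p s) :
    φ t ≤ φ s + p * (t - s) := by
  rcases lt_trichotomy s t with h | rfl | h
  · have := hφ.slope_le_of_hasDerivAt hs ht h hd
    rw [slope_def_field, div_le_iff₀ (sub_pos.2 h)] at this
    linarith
  · simp
  · have := hφ.le_slope_of_hasDerivAt ht hs h hd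
    rw [slope_def_field, le_div_iff₀ (sub_pos.2 h)] at this
    linarith

/-- A sequence that has a cluster point `xb` and whose steps obey, as long as it stays in a ball
around `xb`, a telescoping bound has finite length and converges to `xb`. -/
lemma summable_and_tendsto_of_local_step_bound {E : Type*} [NormedAddCommGroup E]
    [CompleteSpace E] {x : ℕ → E} {xb : E} {b : ℕ → ℝ} {ψ : ℕ → ℕ} {r : ℝ} {N₀ : ℕ} (hr : 0 < r)
    (hψ : StrictMono ψ) (hx : Tendsto (fun k => x (ψ k)) atTop (𝓝 xb))
    (hd : Tendsto (fun n => ‖x (n + 1) - x n‖) atTop (𝓝 0))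
    (hb : Tendsto b atTop (𝓝 0)) (hb0 : ∀ n, N₀ ≤ n → 0 ≤ b n)
    (hstep : ∀ n, N₀ ≤ n → ‖x (n + 1) - xb‖ < r → ‖x (n + 2) - xb‖ < r →
      ‖x (n + 3) - x (n + 2)‖ ≤
        (‖x (n + 2) - x (n + 1)‖ + ‖x (n + 1) - x n‖) / 4 + (b n - b (n + 1))) :
    Summable (fun n => ‖x (n + 1) - x n‖) ∧ Tendsto x atTop (𝓝 xb) := by
  obtain ⟨N, hN, hNr⟩ : ∃ N, N₀ ≤ N ∧ ‖x N - xb‖ + ‖x (N + 1) - x N‖ +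
      ‖x (N + 2) - x (N + 1)‖ +
      (‖x (N + 2) - x (N + 1)‖ + ‖x (N + 1) - x N‖ / 2 + 2 * b N) < r := by
    have hd1 := hd.comp (tendsto_add_atTop_nat 1)
    have hlim : Tendsto (fun k => ‖x (ψ k) - xb‖ + ‖x (ψ k + 1) - x (ψ k)‖ +
        ‖x (ψ k + 2) - x (ψ k + 1)‖ + (‖x (ψ k + 2) - x (ψ k + 1)‖ +
        ‖x (ψ k + 1) - x (ψ k)‖ / 2 + 2 * b (ψ k))) atTop (𝓝 0) := by
      have h1 := hd.comp hψ.tendsto_atTop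
      have h2 := hd1.comp hψ.tendsto_atTop
      have h3 := hb.comp hψ.tendsto_atTop
      have h4 : Tendsto (fun k => ‖x (ψ k) - xb‖) atTop (𝓝 0) :=
        tendsto_iff_norm_sub_tendsto_zero.1 hx
      simpa using ((h4.add h1).add h2).add ((h2.add (h1.div_const 2)).add (h3.const_mul 2))
    obtain ⟨k, hk, hk'⟩ := ((hlim.eventually_lt_const hr).and
      (hψ.tendsto_atTop.eventually_ge_atTop N₀)).exists
    exact ⟨ψ k, hk', hk⟩
  have h0 := hb0 N hN
  have hnn : ∀ n, 0 ≤ ‖x (n + 1) - x n‖ := fun n => norm_nonneg _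
  have key : ∀ k, ‖x (N + k + 1) - xb‖ < r ∧ ‖x (N + k + 2) - xb‖ < r ∧
      ‖x (N + k + 2) - x (N + 2)‖ ≤
        ∑ i ∈ Finset.range k, ‖x (N + 2 + i + 1) - x (N + 2 + i)‖ ∧
      (∑ i ∈ Finset.range k, ‖x (N + 2 + i + 1) - x (N + 2 + i)‖) / 2 +
        ‖x (N + k + 2) - x (N + k + 1)‖ / 2 + ‖x (N + k + 1) - x (N + k)‖ / 4 + b (N + k) ≤
      ‖x (N + 2) - x (N + 1)‖ / 2 + ‖x (N + 1) - x N‖ / 4 + b N := by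
    have hN2 : ‖x (N + 2) - xb‖ ≤ ‖x N - xb‖ + ‖x (N + 1) - x N‖ + ‖x (N + 2) - x (N + 1)‖ := by
      have := norm_add₃_le (a := x N - xb) (b := x (N + 1) - x N) (c := x (N + 2) - x (N + 1))
      rwa [show x N - xb + (x (N + 1) - x N) + (x (N + 2) - x (N + 1)) = x (N + 2) - xb by abel]
        at this
    intro k
    induction k with
    | zero =>
      have hN1 := norm_add_le (x N - xb) (x (N + 1) - x N)
      rw [show x N - xb + (x (N + 1) - x N) = x (N + 1) - xb by abel] at hN1
      have h1 := hnn N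
      have h2 : 0 ≤ ‖x (N + 2) - x (N + 1)‖ := hnn (N + 1)
      refine ⟨by simp; linarith, by simp; linarith, by simp, by simp⟩
    | succ k ih =>
      obtain ⟨i1, i2, i3, i4⟩ := ih
      have hs := hstep (N + k) (by omega) i1 i2
      have hsum := Finset.sum_range_succ (fun i => ‖x (N + 2 + i + 1) - x (N + 2 + i)‖) k
      have e3 : N + 2 + k = N + k + 2 := by omega
      have e4 : N + 2 + k + 1 = N + k + 3 := by omega
      rw [e4, e3] at hsum
      have hb' := hb0 (N + k + 1) (by omega)
      have hdist : ‖x (N + k + 3) - x (N + 2)‖ ≤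
          ∑ i ∈ Finset.range (k + 1), ‖x (N + 2 + i + 1) - x (N + 2 + i)‖ := by
        have := norm_add_le (x (N + k + 3) - x (N + k + 2)) (x (N + k + 2) - x (N + 2))
        rw [sub_add_sub_cancel] at this
        linarith
      have hpot : (∑ i ∈ Finset.range (k + 1), ‖x (N + 2 + i + 1) - x (N + 2 + i)‖) / 2 +
          ‖x (N + k + 3) - x (N + k + 2)‖ / 2 + ‖x (N + k + 2) - x (N + k + 1)‖ / 4 +
          b (N + k + 1) ≤
          ‖x (N + 2) - x (N + 1)‖ / 2 + ‖x (N + 1) - x N‖ / 4 + b N := by linarith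
      refine ⟨i2, ?_, hdist, hpot⟩
      have := norm_add_le (x (N + k + 3) - x (N + 2)) (x (N + 2) - xb)
      rw [sub_add_sub_cancel] at this
      have h1 : 0 ≤ ‖x (N + k + 3) - x (N + k + 2)‖ := norm_nonneg _
      have h2 : 0 ≤ ‖x (N + k + 2) - x (N + k + 1)‖ := norm_nonneg _
      change ‖x (N + k + 3) - xb‖ < r
      linarith
  have hsum : Summable (fun n => ‖x (n + 1) - x n‖) := by
    rw [← summable_nat_add_iff (N + 2)]
    refine summable_of_sum_range_le (c := ‖x (N + 2) - x (N + 1)‖ + ‖x (N + 1) - x N‖ / 2 +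
      2 * b N) (fun n => norm_nonneg _) fun k => ?_
    obtain ⟨-, -, -, i4⟩ := key k
    have h1 : 0 ≤ ‖x (N + k + 2) - x (N + k + 1)‖ := norm_nonneg _
    have h2 : 0 ≤ ‖x (N + k + 1) - x (N + k)‖ := norm_nonneg _
    have h3 := hb0 (N + k) (by omega)
    simp only [add_comm _ (N + 2)]
    linarith
  have hcau : CauchySeq x := by
    refine cauchySeq_of_summable_dist ?_
    simpa only [dist_eq_norm', Nat.succ_eq_add_one] using hsum
  obtain ⟨y, hy⟩ := cauchySeq_tendsto_of_complete hcau
  have : y = xb := tendsto_nhds_unique (hy.comp hψ.tendsto_atTop) hx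
  exact ⟨hsum, this ▸ hy⟩

/-- Finite-length convergence of a two-step descent sequence under the
Kurdyka–Łojasiewicz property. -/
lemma summable_and_tendsto_of_KLAt [CompleteSpace E] {h : WithLp 2 (E × E) → EReal} {x : ℕ → E}
    {xb : E} {e : ℕ → ℝ} {c C ℓ : ℝ} {ψ : ℕ → ℕ} (hc : 0 < c) (hC : 0 ≤ C)
    (hval : ∀ n, h (WithLp.toLp 2 (x (n + 1), x n)) = (e n : EReal))
    (hdesc : ∀ n, c * ‖x (n + 2) - x (n + 1)‖ ^ 2 ≤ e n - e (n + 1))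
    (he : Tendsto e atTop (𝓝 ℓ))
    (hsub : ∀ n, ∃ w ∈ limitingSubdiff h (WithLp.toLp 2 (x (n + 2), x (n + 1))),
      ‖w‖ ≤ C * (‖x (n + 2) - x (n + 1)‖ + ‖x (n + 1) - x n‖))
    (hψ : StrictMono ψ) (hx : Tendsto (fun k => x (ψ k)) atTop (𝓝 xb))
    (hd : Tendsto (fun n => ‖x (n + 1) - x n‖) atTop (𝓝 0))
    (hlim : h (WithLp.toLp 2 (xb, xb)) = (ℓ : EReal))
    (hKL : KLAt h (WithLp.toLp 2 (xb, xb))) :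
    Summable (fun n => ‖x (n + 1) - x n‖) ∧ Tendsto x atTop (𝓝 xb) := by
  obtain ⟨η, hη, U, hU, φ, φ', hφ0, hconc, hcont, hder, -, hpos, hineq⟩ := hKL
  obtain ⟨r, hr, hrU⟩ : ∃ r > 0, ∀ a b : E, ‖a - xb‖ < r → ‖b - xb‖ < r →
      WithLp.toLp 2 (a, b) ∈ U := by
    have h1 : (fun p : E × E => WithLp.toLp 2 p) ⁻¹' U ∈ 𝓝 (xb, xb) :=
      (WithLp.prod_continuous_toLp 2 E E).continuousAt hU
    obtain ⟨r, hr, hsub'⟩ := Metric.mem_nhds_iff.1 h1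
    refine ⟨r, hr, fun a b ha hb => hsub' ?_⟩
    rw [Metric.mem_ball, Prod.dist_eq, max_lt_iff, dist_eq_norm, dist_eq_norm]
    exact ⟨ha, hb⟩
  have hanti : Antitone e := antitone_nat_of_succ_le fun n => by
    have := hdesc n
    nlinarith [sq_nonneg ‖x (n + 2) - x (n + 1)‖]
  have hge : ∀ n, ℓ ≤ e n := fun n => hanti.le_of_tendsto he n
  have he0 : Tendsto (fun n => e n - ℓ) atTop (𝓝 0) := by simpa using he.sub_const ℓ
  have heη : ∀ᶠ n in atTop, ((e n - ℓ : ℝ) : EReal) < η := by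
    have : Tendsto (fun n => ((e n - ℓ : ℝ) : EReal)) atTop (𝓝 0) := by
      exact (continuous_coe_real_ereal.tendsto 0).comp he0
    exact this.eventually_lt_const hη
  obtain ⟨N₀, hN₀⟩ := eventually_atTop.1 heη
  set S : Set ℝ := {s : ℝ | 0 ≤ s ∧ (s : EReal) < η} with hS
  have hmem : ∀ n, N₀ ≤ n → e n - ℓ ∈ S := fun n hn => ⟨sub_nonneg.2 (hge n), hN₀ n hn⟩
  have h0S : (0 : ℝ) ∈ S := ⟨le_rfl, by simpa using hη⟩
  have hφlim : Tendsto (fun n => φ (e n - ℓ)) atTop (𝓝 0) := by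
    have h1 : Tendsto (fun n => e n - ℓ) atTop (𝓝[S] 0) :=
      tendsto_nhdsWithin_iff.2 ⟨he0, eventually_atTop.2 ⟨N₀, hmem⟩⟩
    exact hφ0 ▸ (hcont 0 h0S).tendsto.comp h1
  have hφnn : ∀ s ∈ S, 0 ≤ φ s := by
    intro s hs
    rcases hs.1.eq_or_lt with rfl | hs0
    · exact hφ0.ge
    · have h1 := hconc.le_add_mul_of_hasDerivAt hs h0S (hder s hs0 hs.2)
      nlinarith [hpos s hs0 hs.2]
  refine summable_and_tendsto_of_local_step_bound (b := fun n => C / c * φ (e (n + 1) - ℓ))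
    (N₀ := N₀) hr hψ hx hd ?_ ?_ ?_
  · simpa using (hφlim.comp (tendsto_add_atTop_nat 1)).const_mul (C / c)
  · exact fun n hn => mul_nonneg (by positivity) (hφnn _ (hmem _ (by omega)))
  · intro n hn hx1 hx2
    have hm1 := hmem (n + 1) (by omega)
    have hm2 := hmem (n + 2) (by omega)
    have hdes := hdesc (n + 1)
    simp only [show n + 1 + 2 = n + 3 from rfl, show n + 1 + 1 = n + 2 from rfl] at hdes ⊢
    set D := ‖x (n + 3) - x (n + 2)‖ with hD
    set s := ‖x (n + 2) - x (n + 1)‖ + ‖x (n + 1) - x n‖ with hs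
    have hs0 : 0 ≤ s := by positivity
    have hD0 : 0 ≤ D := norm_nonneg _
    rcases hm1.1.eq_or_lt with hz | hp
    · have h2 : e (n + 2) - ℓ = 0 := le_antisymm (hz ▸ by
        linarith [hanti (Nat.le_succ (n + 1))]) hm2.1
      have hD2 : D ^ 2 ≤ 0 := by
        by_contra! hcon
        nlinarith [mul_pos hc hcon]
      have : D = 0 := by nlinarith
      rw [this, h2, ← hz]
      simp only [sub_self, add_zero]
      positivity
    · have hφp := hpos _ hp hm1.2
      have htan := hconc.le_add_mul_of_hasDerivAt hm1 hm2 (hder _ hp hm1.2)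
      obtain ⟨w, hw, hwn⟩ := hsub n
      have hKLn := hineq _ (hrU _ _ hx2 hx1)
      have hvn : h (WithLp.toLp 2 (x (n + 2), x (n + 1))) = (e (n + 1) : EReal) := hval (n + 1)
      rw [hvn, hlim] at hKLn
      have h1 := hKLn (by exact_mod_cast sub_pos.1 hp) (by
        have := EReal.add_lt_add_left_coe hm1.2 ℓ
        rwa [← EReal.coe_add, add_sub_cancel] at this)
      rw [← EReal.coe_sub, EReal.toReal_coe] at h1
      have h2 : (1 : ENNReal) ≤ ENNReal.ofReal (φ' (e (n + 1) - ℓ) * ‖w‖) := by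
        rw [ENNReal.ofReal_mul hφp.le]
        refine h1.trans (mul_le_mul_right ?_ _)
        refine (Metric.infEDist_le_edist_of_mem hw).trans_eq ?_
        rw [edist_comm, edist_zero_right, ofReal_norm]
      rw [ENNReal.one_le_ofReal] at h2
      set p := φ' (e (n + 1) - ℓ)
      have h3 : 1 ≤ p * (C * s) := h2.trans (mul_le_mul_of_nonneg_left hwn hφp.le)
      have h4 : p * (e (n + 1) - e (n + 2)) ≤ φ (e (n + 1) - ℓ) - φ (e (n + 2) - ℓ) := by
        linarith
      have hΔ : 0 ≤ e (n + 1) - e (n + 2) := sub_nonneg.2 (hanti (Nat.le_succ (n + 1)))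
      have h5 : c * D ^ 2 ≤ (C * s) * (φ (e (n + 1) - ℓ) - φ (e (n + 2) - ℓ)) := by
        have hCs : 0 ≤ C * s := by positivity
        calc c * D ^ 2 ≤ e (n + 1) - e (n + 2) := hdes
          _ ≤ (p * (C * s)) * (e (n + 1) - e (n + 2)) := le_mul_of_one_le_left hΔ h3
          _ = (C * s) * (p * (e (n + 1) - e (n + 2))) := by ring
          _ ≤ _ := mul_le_mul_of_nonneg_left h4 hCs
      set B := φ (e (n + 1) - ℓ) - φ (e (n + 2) - ℓ) with hB
      have hB0 : 0 ≤ B := (mul_nonneg hφp.le hΔ).trans h4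
      have h6 : D ^ 2 ≤ s * (C / c * B) := by
        rw [← mul_le_mul_iff_right₀ hc]
        refine h5.trans_eq ?_
        field_simp
      have hK0 : 0 ≤ C / c * B := by positivity
      have h7 : D ≤ s / 4 + C / c * B := by
        refine abs_le_of_sq_le_sq' (h6.trans ?_) (by positivity) |>.2
        nlinarith [sq_nonneg (s / 4 - C / c * B)]
      rw [← mul_sub]
      exact h7

/-- A minimizer of a proper function plus a finite one lies in the effective domain. -/
lemma ne_top_of_forall_add_mul_le {X : Type*} {f : X → EReal} {D : X → ℝ} {a : ℝ} {y : X}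
    (ha : 0 < a) (hbot : ∀ z, f z ≠ ⊥) (hproper : ∃ z, f z ≠ ⊤)
    (hmin : ∀ u, (D y : EReal) + (a : EReal) * f y ≤ (D u : EReal) + (a : EReal) * f u) :
    f y ≠ ⊤ := by
  obtain ⟨z, hz⟩ := hproper
  intro hy
  have h := hmin z
  lift f z to ℝ using ⟨hz, hbot z⟩ with t
  rw [hy, EReal.coe_mul_top_of_pos ha, EReal.coe_add_top, top_le_iff] at h
  exact absurd h (by rw [← EReal.coe_mul, ← EReal.coe_add]; exact EReal.coe_ne_top _)

lemma toReal_le_of_forall_add_mul_le {X : Type*} {f : X → EReal} {D : X → ℝ} {a : ℝ} {y : X}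
    (hbot : ∀ z, f z ≠ ⊥) (hy : f y ≠ ⊤)
    (hmin : ∀ u, (D y : EReal) + (a : EReal) * f y ≤ (D u : EReal) + (a : EReal) * f u)
    {u : X} (hu : f u ≠ ⊤) :
    D y + a * (f y).toReal ≤ D u + a * (f u).toReal := by
  have h := hmin u
  rw [← EReal.coe_toReal hy (hbot y), ← EReal.coe_toReal hu (hbot u)] at h
  exact_mod_cast h

/-- Fermat's rule for the sum of a differentiable function and a positive multiple of `f`. -/
lemma mem_frechetSubdiff_of_forall_add_mul_le [CompleteSpace E] {f : E → EReal} {D : E → ℝ}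
    {a : ℝ} {y q : E} (ha : 0 < a) (hbot : ∀ z, f z ≠ ⊥) (hy : f y ≠ ⊤)
    (hmin : ∀ u, (D y : EReal) + (a : EReal) * f y ≤ (D u : EReal) + (a : EReal) * f u)
    (hD : HasGradientAt D q y) :
    -(a⁻¹ • q) ∈ frechetSubdiff f y := by
  refine ⟨hy, fun ε hε => ?_⟩
  have h := (hasGradientAt_iff_isLittleO.1 hD).def (mul_pos ha hε)
  filter_upwards [h] with u hu
  by_cases hfu : f u = ⊤
  · simp [hfu]
  have hm := toReal_le_of_forall_add_mul_le hbot hy hmin hfu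
  rw [← EReal.coe_toReal hfu (hbot u)]
  norm_cast
  rw [Real.norm_eq_abs] at hu
  have h1 := (le_abs_self _).trans hu
  rw [inner_neg_left, real_inner_smul_left, ← mul_le_mul_iff_right₀ ha]
  have h2 : a * ((f y).toReal + -(a⁻¹ * ⟪q, u - y⟫) - ε * ‖u - y‖) =
      a * (f y).toReal - ⟪q, u - y⟫ - a * ε * ‖u - y‖ := by
    field_simp
    ring
  linarith

/-- The sum rule for Fréchet subgradients of a function precomposed with a nonexpansive
continuous map plus a differentiable function. -/
lemma add_mem_frechetSubdiff {E' : Type*} [NormedAddCommGroup E'] [InnerProductSpace ℝ E']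
    [CompleteSpace E'] {f : E → EReal} {h : E' → EReal} {π : E' → E} {Q : E' → ℝ} {y q v' : E'}
    {v : E} (hπ : Continuous π) (hπ' : ∀ p, ‖π p - π y‖ ≤ ‖p - y‖)
    (hh : ∀ p, h p = f (π p) + (Q p : EReal)) (hbot : ∀ z, f z ≠ ⊥)
    (hv : v ∈ frechetSubdiff f (π y)) (hv' : ∀ p, ⟪v', p - y⟫ = ⟪v, π p - π y⟫)
    (hQ : HasGradientAt Q q y) :
    v' + q ∈ frechetSubdiff h y := by
  obtain ⟨hy, hv⟩ := hv
  have hval : h y = (((f (π y)).toReal + Q y : ℝ) : EReal) := by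
    rw [hh, EReal.coe_add, EReal.coe_toReal hy (hbot _)]
  refine ⟨hval ▸ EReal.coe_ne_top _, fun ε hε => ?_⟩
  have h1 := (hasGradientAt_iff_isLittleO.1 hQ).def (half_pos hε)
  have h2 := hπ.continuousAt.eventually (hv (ε / 2) (half_pos hε))
  filter_upwards [h1, h2] with u hu1 hu2
  rw [hval, hh, EReal.toReal_coe]
  refine le_trans ?_ (add_le_add_left hu2 _)
  norm_cast
  rw [Real.norm_eq_abs] at hu1
  have h3 := (neg_abs_le _).trans' (neg_le_neg hu1)
  rw [inner_add_left, hv']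
  nlinarith [hπ' u]

lemma frechetSubdiff_subset_limitingSubdiff (h : E → EReal) (x : E) :
    frechetSubdiff h x ⊆ limitingSubdiff h x := fun v hv =>
  ⟨hv.1, fun _ => x, fun _ => v, tendsto_const_nhds, tendsto_const_nhds, fun _ => hv,
    tendsto_const_nhds⟩

lemma WithLp.norm_toLp_prod_le {E : Type*} [NormedAddCommGroup E] (a b : E) :
    ‖WithLp.toLp 2 (a, b)‖ ≤ ‖a‖ + ‖b‖ := by
  rw [WithLp.prod_norm_eq_of_L2]
  refine Real.sqrt_le_iff.2 ⟨by positivity, ?_⟩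
  simp only [WithLp.toLp_fst, WithLp.toLp_snd]
  nlinarith [norm_nonneg a, norm_nonneg b, mul_nonneg (norm_nonneg a) (norm_nonneg b)]

/-- The gradient of the smooth part of the regularized objective. -/
lemma hasGradientAt_fst_add_norm_sq [CompleteSpace E] {g : E → ℝ} (hg : Differentiable ℝ g)
    (M : ℝ) (p : WithLp 2 (E × E)) :
    HasGradientAt (fun p : WithLp 2 (E × E) => g p.fst + M * ‖p.fst - p.snd‖ ^ 2)
      (WithLp.toLp 2 (gradient g p.fst + (2 * M) • (p.fst - p.snd),
        -((2 * M) • (p.fst - p.snd)))) p := by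
  rw [hasGradientAt_iff_hasFDerivAt]
  have h1 : HasFDerivAt (fun p : WithLp 2 (E × E) => p.fst) (WithLp.fstL 2 ℝ E E) p :=
    (WithLp.fstL 2 ℝ E E).hasFDerivAt
  have h2 : HasFDerivAt (fun p : WithLp 2 (E × E) => p.snd) (WithLp.sndL 2 ℝ E E) p :=
    (WithLp.sndL 2 ℝ E E).hasFDerivAt
  have h3 := (hg p.fst).hasGradientAt.hasFDerivAt.comp p h1
  have h4 := (h1.sub h2).norm_sq.const_mul M
  refine (h3.add h4).congr_fderiv ?_
  ext y
  simp [WithLp.prod_inner_apply, inner_add_left, inner_sub_left, real_inner_smul_left]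
  ring

/-- The smooth part of the objective of one inertial Bregman forward-backward step. -/
def bregmanModel [CompleteSpace E] (F g : E → ℝ) (a b : ℝ) (x₀ x₁ u : E) : ℝ :=
  F u - F x₁ - ⟪gradient F x₁, u - x₁⟫ + a * ⟪u, gradient g x₁⟫ + b * ⟪u, x₀ - x₁⟫

lemma hasGradientAt_bregmanModel [CompleteSpace E] {F g : E → ℝ} (hF : Differentiable ℝ F)
    (a b : ℝ) (x₀ x₁ y : E) :
    HasGradientAt (bregmanModel F g a b x₀ x₁)
      (gradient F y - gradient F x₁ + a • gradient g x₁ + b • (x₀ - x₁)) y := by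
  rw [hasGradientAt_iff_hasFDerivAt]
  have h1 := (hF y).hasGradientAt.hasFDerivAt
  have h2 : ∀ q z : E, HasFDerivAt (fun u : E => ⟪q, u⟫) (innerSL ℝ q) z :=
    fun q _ => (innerSL ℝ q).hasFDerivAt
  have h3 := (h2 (gradient F x₁) _).comp y ((hasFDerivAt_id y).sub_const x₁)
  have h4 := (h2 (gradient g x₁) y).const_mul a
  have h5 := (h2 (x₀ - x₁) y).const_mul b
  have h6 := (((h1.sub_const (F x₁)).sub h3).add h4).add h5
  simp only [real_inner_comm _ (gradient g x₁), real_inner_comm _ (x₀ - x₁)] at h6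
  refine h6.congr_fderiv ?_
  ext u
  simp

/-- The one-step decrease estimate. -/
lemma bregman_step_descent [CompleteSpace E] {f : E → EReal} {F g : E → ℝ}
    {σ L αlo αhi β a b μ : ℝ} {x₀ x₁ y : E} (hbot : ∀ z, f z ≠ ⊥) (hσ : 0 < σ)
    (hFconv : ConvexOn ℝ Set.univ fun z => F z - σ / 2 * ‖z‖ ^ 2) (hF : Differentiable ℝ F)
    (hg : Differentiable ℝ g) (hL : ∀ z w, ‖gradient g z - gradient g w‖ ≤ L * ‖z - w‖)
    (hαlo : 0 < αlo) (ha : αlo ≤ a) (ha' : a ≤ αhi) (hb : 0 ≤ b) (hb' : b ≤ β) (hμ : 0 < μ)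
    (hmin : ∀ u, (bregmanModel F g a b x₀ x₁ y : EReal) + (a : EReal) * f y ≤
      (bregmanModel F g a b x₀ x₁ u : EReal) + (a : EReal) * f u)
    (hy : f y ≠ ⊤) (hx₁ : f x₁ ≠ ⊤) :
    (f y).toReal + g y +
        ((σ - αhi * L) / (2 * αhi) - μ * β / (2 * αlo)) * ‖y - x₁‖ ^ 2 ≤
      (f x₁).toReal + g x₁ + β / (2 * μ * αlo) * ‖x₁ - x₀‖ ^ 2 := by
  have ha0 : 0 < a := hαlo.trans_le ha
  have hhi : 0 < αhi := ha0.trans_le ha'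
  have hβ : 0 ≤ β := hb.trans hb'
  have h1 := toReal_le_of_forall_add_mul_le hbot hy hmin hx₁
  simp only [bregmanModel, sub_self, inner_zero_right] at h1
  have h2 := bregman_ge_of_strongConvex hFconv hF x₁ y
  have h3 := le_add_inner_of_lipschitz_gradient hg hL x₁ y
  have h4 : -(b * ⟪y - x₁, x₀ - x₁⟫) ≤
      β * (μ / 2 * ‖y - x₁‖ ^ 2 + 1 / (2 * μ) * ‖x₁ - x₀‖ ^ 2) := by
    have i1 : -⟪y - x₁, x₀ - x₁⟫ ≤ ‖y - x₁‖ * ‖x₁ - x₀‖ := by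
      rw [← inner_neg_right, neg_sub]
      exact real_inner_le_norm _ _
    have i2 : ‖y - x₁‖ * ‖x₁ - x₀‖ ≤
        μ / 2 * ‖y - x₁‖ ^ 2 + 1 / (2 * μ) * ‖x₁ - x₀‖ ^ 2 := by
      have : μ / 2 * ‖y - x₁‖ ^ 2 + 1 / (2 * μ) * ‖x₁ - x₀‖ ^ 2 - ‖y - x₁‖ * ‖x₁ - x₀‖ =
          (μ * ‖y - x₁‖ - ‖x₁ - x₀‖) ^ 2 / (2 * μ) := by
        field_simp
        ring
      have : 0 ≤ (μ * ‖y - x₁‖ - ‖x₁ - x₀‖) ^ 2 / (2 * μ) := by positivity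
      linarith
    calc -(b * ⟪y - x₁, x₀ - x₁⟫) = b * -⟪y - x₁, x₀ - x₁⟫ := by ring
      _ ≤ b * (μ / 2 * ‖y - x₁‖ ^ 2 + 1 / (2 * μ) * ‖x₁ - x₀‖ ^ 2) :=
        mul_le_mul_of_nonneg_left (i1.trans i2) hb
      _ ≤ _ := mul_le_mul_of_nonneg_right hb' (by positivity)
  set d := ‖y - x₁‖ ^ 2 with hd
  set K := μ / 2 * d + 1 / (2 * μ) * ‖x₁ - x₀‖ ^ 2 with hK
  have hd0 : 0 ≤ d := by positivity
  have hK0 : 0 ≤ K := by positivity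
  have h5 : a * ((f y).toReal + g y - (f x₁).toReal - g x₁ - L / 2 * d) ≤
      -(σ / 2 * d) + β * K := by
    rw [inner_sub_left] at h4
    rw [real_inner_comm, inner_sub_left] at h3
    have := mul_le_mul_of_nonneg_left h3 ha0.le
    linarith
  have h6 : (f y).toReal + g y - (f x₁).toReal - g x₁ - L / 2 * d ≤
      -(σ / 2 * d) / αhi + β * K / αlo := by
    rw [mul_comm, ← le_div_iff₀ ha0, add_div] at h5
    refine h5.trans (add_le_add ?_ (div_le_div_of_nonneg_left (by positivity) hαlo ha))
    rw [neg_div, neg_div, neg_le_neg_iff]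
    exact div_le_div_of_nonneg_left (by positivity) ha0 ha'
  have h7 : -(σ / 2 * d) / αhi + β * K / αlo + L / 2 * d =
      β / (2 * μ * αlo) * ‖x₁ - x₀‖ ^ 2 -
        ((σ - αhi * L) / (2 * αhi) - μ * β / (2 * αlo)) * d := by
    rw [hK]
    field_simp
    ring
  linarith

/-- Subgradients of `f + g` and of its regularization at the new iterate, controlled by the
last two steps. -/
lemma bregman_step_subgradient [CompleteSpace E] {f : E → EReal} {F g : E → ℝ}
    {L LF M αlo β a b : ℝ} {x₀ x₁ y : E} {H : WithLp 2 (E × E) → EReal}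
    (hbot : ∀ z, f z ≠ ⊥) (hF : Differentiable ℝ F)
    (hFlip : ∀ z w, ‖gradient F z - gradient F w‖ ≤ LF * ‖z - w‖)
    (hg : Differentiable ℝ g) (hL : ∀ z w, ‖gradient g z - gradient g w‖ ≤ L * ‖z - w‖)
    (hM : 0 ≤ M) (hαlo : 0 < αlo) (ha : αlo ≤ a) (hb : 0 ≤ b) (hb' : b ≤ β)
    (hmin : ∀ u, (bregmanModel F g a b x₀ x₁ y : EReal) + (a : EReal) * f y ≤
      (bregmanModel F g a b x₀ x₁ u : EReal) + (a : EReal) * f u)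
    (hy : f y ≠ ⊤)
    (hH : ∀ p, H p = f p.fst + ((g p.fst + M * ‖p.fst - p.snd‖ ^ 2 : ℝ) : EReal)) :
    (∃ v ∈ frechetSubdiff (fun w => f w + (g w : EReal)) y,
      ‖v‖ ≤ (LF / αlo + L) * ‖y - x₁‖ + β / αlo * ‖x₁ - x₀‖) ∧
    ∃ w ∈ frechetSubdiff H (WithLp.toLp 2 (y, x₁)),
      ‖w‖ ≤ (LF / αlo + L + 4 * M) * ‖y - x₁‖ + β / αlo * ‖x₁ - x₀‖ := by
  have ha0 : 0 < a := hαlo.trans_le ha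
  have hv := mem_frechetSubdiff_of_forall_add_mul_le ha0 hbot hy hmin
    (hasGradientAt_bregmanModel hF a b x₀ x₁ y)
  set v := -(a⁻¹ • (gradient F y - gradient F x₁ + a • gradient g x₁ + b • (x₀ - x₁))) with hvdef
  have hnorm : ‖v + gradient g y‖ ≤ (LF / αlo + L) * ‖y - x₁‖ + β / αlo * ‖x₁ - x₀‖ := by
    have e : v + gradient g y = -(a⁻¹ • (gradient F y - gradient F x₁)) +
        (gradient g y - gradient g x₁) + (a⁻¹ * b) • (x₁ - x₀) := by
      rw [hvdef, smul_add, smul_add, smul_smul, smul_smul, inv_mul_cancel₀ ha0.ne', one_smul,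
        ← neg_sub x₁ x₀, smul_neg]
      abel
    rw [e]
    refine norm_add₃_le.trans ?_
    rw [norm_neg, norm_smul, norm_smul, Real.norm_of_nonneg (inv_nonneg.2 ha0.le),
      Real.norm_of_nonneg (by positivity : 0 ≤ a⁻¹ * b)]
    have hinv : a⁻¹ ≤ αlo⁻¹ := inv_anti₀ hαlo ha
    have i1 : a⁻¹ * ‖gradient F y - gradient F x₁‖ ≤ αlo⁻¹ * (LF * ‖y - x₁‖) :=
      mul_le_mul hinv (hFlip _ _) (norm_nonneg _) (by positivity)
    have i2 : a⁻¹ * b ≤ αlo⁻¹ * β := mul_le_mul hinv hb' hb (by positivity)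
    have i3 := mul_le_mul_of_nonneg_right i2 (norm_nonneg (x₁ - x₀))
    have i4 := hL y x₁
    calc _ ≤ αlo⁻¹ * (LF * ‖y - x₁‖) + L * ‖y - x₁‖ + αlo⁻¹ * β * ‖x₁ - x₀‖ := by linarith
      _ = _ := by ring
  refine ⟨⟨v + gradient g y, ?_, hnorm⟩, ?_⟩
  · exact add_mem_frechetSubdiff (π := id) continuous_id (fun p => le_rfl) (fun p => rfl) hbot hv
      (fun p => rfl) (hg y).hasGradientAt
  · refine ⟨WithLp.toLp 2 (v, 0) + WithLp.toLp 2 (gradient g y + (2 * M) • (y - x₁),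
        -((2 * M) • (y - x₁))), ?_, ?_⟩
    · refine add_mem_frechetSubdiff (π := WithLp.fst) (WithLp.fstL 2 ℝ E E).continuous
        (fun p => ?_) hH hbot (by exact hv) (fun p => ?_)
        (hasGradientAt_fst_add_norm_sq hg M (WithLp.toLp 2 (y, x₁)))
      · rw [← WithLp.sub_fst]
        exact WithLp.norm_fst_le _ _
      · simp [WithLp.prod_inner_apply]
    · rw [← WithLp.toLp_add, Prod.mk_add_mk, zero_add]
      refine (WithLp.norm_toLp_prod_le _ _).trans ?_
      rw [← add_assoc, norm_neg]
      have := norm_add_le (v + gradient g y) ((2 * M) • (y - x₁))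
      rw [norm_smul, Real.norm_of_nonneg (by positivity : 0 ≤ 2 * M)] at *
      linarith

/-- Along convergent iterates the values of `f` converge as well. -/
lemma tendsto_toReal_of_bregman_steps [CompleteSpace E] {f : E → EReal} {F g : E → ℝ}
    {αlo β : ℝ} {a b : ℕ → ℝ} {x₀ x₁ y : ℕ → E} {xb : E}
    (hbot : ∀ z, f z ≠ ⊥) (hlsc : LowerSemicontinuous f)
    (hF : Continuous F) (hF' : Continuous (gradient F)) (hg' : Continuous (gradient g))
    (hαlo : 0 < αlo) (ha : ∀ k, αlo ≤ a k) (hb : ∀ k, 0 ≤ b k) (hb' : ∀ k, b k ≤ β)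
    (hmin : ∀ k u, (bregmanModel F g (a k) (b k) (x₀ k) (x₁ k) (y k) : EReal) +
      (a k : EReal) * f (y k) ≤
      (bregmanModel F g (a k) (b k) (x₀ k) (x₁ k) u : EReal) + (a k : EReal) * f u)
    (hy : ∀ k, f (y k) ≠ ⊤) (hxb : f xb ≠ ⊤)
    (hx₀ : Tendsto x₀ atTop (𝓝 xb)) (hx₁ : Tendsto x₁ atTop (𝓝 xb))
    (hyl : Tendsto y atTop (𝓝 xb)) :
    Tendsto (fun k => (f (y k)).toReal) atTop (𝓝 (f xb).toReal) := by
  set R : ℕ → ℝ := fun k => αlo⁻¹ * (|F xb - F (y k)| + ‖gradient F (x₁ k)‖ * ‖xb - y k‖ +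
    β * (‖xb - y k‖ * ‖x₀ k - x₁ k‖)) + ‖xb - y k‖ * ‖gradient g (x₁ k)‖ with hR
  have hRlim : Tendsto R atTop (𝓝 0) := by
    have t1 : Tendsto (fun k => ‖xb - y k‖) atTop (𝓝 0) := by
      simpa using (hyl.const_sub xb).norm
    have t2 : Tendsto (fun k => ‖x₀ k - x₁ k‖) atTop (𝓝 0) := by
      simpa using (hx₀.sub hx₁).norm
    have t3 : Tendsto (fun k => ‖gradient F (x₁ k)‖) atTop (𝓝 ‖gradient F xb‖) :=
      ((hF'.tendsto xb).comp hx₁).norm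
    have t4 : Tendsto (fun k => ‖gradient g (x₁ k)‖) atTop (𝓝 ‖gradient g xb‖) :=
      ((hg'.tendsto xb).comp hx₁).norm
    have t5 : Tendsto (fun k => |F xb - F (y k)|) atTop (𝓝 0) := by
      have := ((hF.tendsto xb).comp hyl).const_sub (F xb)
      simpa using this.abs
    simpa using ((((t5.add (t3.mul t1)).add ((t1.mul t2).const_mul β)).const_mul αlo⁻¹).add
      (t1.mul t4))
  have hle : ∀ k, (f (y k)).toReal ≤ (f xb).toReal + R k := by
    intro k
    have ha0 : 0 < a k := hαlo.trans_le (ha k)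
    have h1 := toReal_le_of_forall_add_mul_le hbot (hy k) (hmin k) hxb
    set A := |F xb - F (y k)| + ‖gradient F (x₁ k)‖ * ‖xb - y k‖ +
      β * (‖xb - y k‖ * ‖x₀ k - x₁ k‖) with hA
    have i1 := le_abs_self (F xb - F (y k))
    have i2 : -⟪gradient F (x₁ k), xb - y k⟫ ≤ ‖gradient F (x₁ k)‖ * ‖xb - y k‖ :=
      (neg_le_abs _).trans (abs_real_inner_le_norm _ _)
    have i3 := real_inner_le_norm (xb - y k) (gradient g (x₁ k))
    have i4 : b k * ⟪xb - y k, x₀ k - x₁ k⟫ ≤ β * (‖xb - y k‖ * ‖x₀ k - x₁ k‖) :=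
      (mul_le_mul_of_nonneg_left (real_inner_le_norm _ _) (hb k)).trans
        (mul_le_mul_of_nonneg_right (hb' k) (by positivity))
    have i5 := mul_le_mul_of_nonneg_left i3 ha0.le
    have hA0 : 0 ≤ A := by
      have := (hb k).trans (hb' k)
      positivity
    have h2 : a k * ((f (y k)).toReal - (f xb).toReal -
        ‖xb - y k‖ * ‖gradient g (x₁ k)‖) ≤ A := by
      simp only [bregmanModel, inner_sub_right, inner_sub_left] at h1 i2 i4 i5
      linarith
    rw [mul_comm, ← le_div_iff₀ ha0] at h2
    have h3 := h2.trans (div_le_div_of_nonneg_left hA0 hαlo (ha k))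
    rw [div_eq_inv_mul] at h3
    simp only [hR]
    linarith
  refine tendsto_order.2 ⟨fun t ht => ?_, fun t ht => ?_⟩
  · have h1 : (t : EReal) < f xb := by
      rw [← EReal.coe_toReal hxb (hbot xb)]
      exact_mod_cast ht
    filter_upwards [hyl.eventually (hlsc xb t h1)] with k hk
    rw [← EReal.coe_toReal (hy k) (hbot _)] at hk
    exact_mod_cast hk
  · have h1 : Tendsto (fun k => (f xb).toReal + R k) atTop (𝓝 (f xb).toReal) := by
      simpa using hRlim.const_add (f xb).toReal
    filter_upwards [h1.eventually_lt_const ht] with k hk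
    exact (hle k).trans_lt hk

lemma continuous_gradient_of_lipschitz [CompleteSpace E] {g : E → ℝ} {L : ℝ} (hL0 : 0 ≤ L)
    (hL : ∀ z w, ‖gradient g z - gradient g w‖ ≤ L * ‖z - w‖) : Continuous (gradient g) :=
  (LipschitzWith.of_dist_le_mul (K := ⟨L, hL0⟩) fun z w => by
    rw [dist_eq_norm, dist_eq_norm]; exact hL z w).continuous

/-- A set on which a coercive function is bounded above is bounded. -/
lemma exists_norm_bound_of_coercive {E : Type*} [NormedAddCommGroup E] {h : E → EReal}
    (hcoer : Tendsto h (comap (fun z : E => ‖z‖) atTop) (𝓝 ⊤)) (t : ℝ) :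
    ∃ R, ∀ z, h z ≤ t → ‖z‖ ≤ R := by
  have h1 := hcoer.eventually_const_lt (EReal.coe_lt_top t)
  obtain ⟨R, hR⟩ := eventually_atTop.1 (eventually_comap.1 h1)
  refine ⟨R, fun z hz => ?_⟩
  by_contra! hcon
  exact absurd (hR _ hcon.le z rfl) hz.not_gt

/-- Theorem 3.7: if `f + g` is coercive and
`H(x,y) = (f+g)(x) + M2‖x-y‖²` is a KL function, then the iterates of Algorithm 1
satisfy `∑ ‖x_{n+1} - x_n‖ < +∞` and converge to a critical point of `f + g`. -/
theorem stmt15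
    (m : ℕ)
    (f : EuclideanSpace ℝ (Fin m) → EReal)
    -- `f` is proper (never `⊥`, somewhere finite), lower semicontinuous and bounded below
    (hfbot : ∀ z, f z ≠ ⊥) (hfproper : ∃ z, f z ≠ ⊤)
    (hflsc : LowerSemicontinuous f)
    (hfbdd : ∃ cl : ℝ, ∀ z, (cl : EReal) ≤ f z)
    -- `g` is differentiable with `Lg`-Lipschitz gradient
    (g : EuclideanSpace ℝ (Fin m) → ℝ) (Lg : ℝ) (hLg : 0 ≤ Lg)
    (hgdiff : Differentiable ℝ g)
    (hglip : ∀ z w, ‖gradient g z - gradient g w‖ ≤ Lg * ‖z - w‖)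
    -- `F` is `σ`-strongly convex and differentiable with `LF`-Lipschitz gradient
    (F : EuclideanSpace ℝ (Fin m) → ℝ) (σ LF : ℝ) (hσ : 0 < σ) (hLF : 0 < LF)
    (hFconv : ConvexOn ℝ Set.univ fun z => F z - σ / 2 * ‖z‖ ^ 2)
    (hFdiff : Differentiable ℝ F)
    (hFlip : ∀ z w, ‖gradient F z - gradient F w‖ ≤ LF * ‖z - w‖)
    -- parameters of the algorithm
    (αlo αhi β : ℝ) (hαlo : 0 < αlo) (hαorder : αlo ≤ αhi) (hβ : 0 ≤ β)
    (α βs : ℕ → ℝ)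
    (hα : ∀ n, 1 ≤ n → αlo ≤ α n ∧ α n ≤ αhi)
    (hβs : ∀ n, 1 ≤ n → 0 ≤ βs n ∧ βs n ≤ β)
    -- the sequence generated by Algorithm 1:
    -- `x (n+1)` minimizes `u ↦ D_F(u, x n) + α n • ⟪u, ∇g(x n)⟫ + βs n • ⟪u, x (n-1) - x n⟫ + α n • f u`
    (x : ℕ → EuclideanSpace ℝ (Fin m))
    (halg : ∀ n, 1 ≤ n → ∀ u,
      ((F (x (n + 1)) - F (x n) - ⟪gradient F (x n), x (n + 1) - x n⟫
          + α n * ⟪x (n + 1), gradient g (x n)⟫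
          + βs n * ⟪x (n + 1), x (n - 1) - x n⟫ : ℝ) : EReal)
        + (α n : EReal) * f (x (n + 1))
      ≤ ((F u - F (x n) - ⟪gradient F (x n), u - x n⟫
          + α n * ⟪u, gradient g (x n)⟫
          + βs n * ⟪u, x (n - 1) - x n⟫ : ℝ) : EReal)
        + (α n : EReal) * f u)
    -- the parameters `μ, αlo, β` satisfy `μ(σ - Lg·αlo) > β(μ² + 1)` and `αhi` is chosen
    -- with `αlo < αhi` such that `M1 > M2`
    (μ : ℝ) (hμ : 0 < μ)
    (hcond : β * (μ ^ 2 + 1) < μ * (σ - Lg * αlo))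
    (M1 M2 : ℝ)
    (hM1 : M1 = (σ - αhi * Lg) / (2 * αhi) - μ * β / (2 * αlo))
    (hM2 : M2 = β / (2 * μ * αlo))
    (hαstrict : αlo < αhi) (hM : M2 < M1)

    -- `f + g` is coercive
    (hcoer : Tendsto (fun z => f z + ((g z : ℝ) : EReal))
      (comap (fun z : EuclideanSpace ℝ (Fin m) => ‖z‖) atTop) (𝓝 ⊤))

    -- `H(x, y) = (f+g)(x) + M2‖x - y‖²` on the Euclidean product space
    (H : WithLp 2 (EuclideanSpace ℝ (Fin m) × EuclideanSpace ℝ (Fin m)) → EReal)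
    (hH : ∀ p, H p = f (WithLp.equiv 2 _ p).1
      + ((g (WithLp.equiv 2 _ p).1 + M2 * ‖(WithLp.equiv 2 _ p).1 - (WithLp.equiv 2 _ p).2‖ ^ 2 : ℝ) : EReal))
    (hKL : KLFunction H) :
    Summable (fun n => ‖x (n + 1) - x n‖) ∧
    ∃ xb, (0 : EuclideanSpace ℝ (Fin m)) ∈
        limitingSubdiff (fun w => f w + ((g w : ℝ) : EReal)) xb ∧
      Tendsto x atTop (𝓝 xb) := by
  have hM20 : 0 ≤ M2 := hM2 ▸ by positivity
  have hmin : ∀ n u, (bregmanModel F g (α (n + 1)) (βs (n + 1)) (x n) (x (n + 1)) (x (n + 2)) :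
      EReal) + (α (n + 1) : EReal) * f (x (n + 2)) ≤
      (bregmanModel F g (α (n + 1)) (βs (n + 1)) (x n) (x (n + 1)) u : EReal) +
        (α (n + 1) : EReal) * f u := fun n u => halg (n + 1) (by omega) u
  have hα1 : ∀ n, αlo ≤ α (n + 1) := fun n => (hα (n + 1) (by omega)).1
  have hα2 : ∀ n, α (n + 1) ≤ αhi := fun n => (hα (n + 1) (by omega)).2
  have hβ1 : ∀ n, 0 ≤ βs (n + 1) := fun n => (hβs (n + 1) (by omega)).1
  have hβ2 : ∀ n, βs (n + 1) ≤ β := fun n => (hβs (n + 1) (by omega)).2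
  have hfin : ∀ n, f (x (n + 2)) ≠ ⊤ := fun n =>
    ne_top_of_forall_add_mul_le (hαlo.trans_le (hα1 n)) hfbot hfproper (hmin n)
  have hH' : ∀ p, H p = f p.fst + ((g p.fst + M2 * ‖p.fst - p.snd‖ ^ 2 : ℝ) : EReal) := hH
  set e : ℕ → ℝ := fun n =>
    (f (x (n + 2))).toReal + g (x (n + 2)) + M2 * ‖x (n + 2) - x (n + 1)‖ ^ 2 with he
  have hdesc : ∀ n, (M1 - M2) * ‖x (n + 3) - x (n + 2)‖ ^ 2 ≤ e n - e (n + 1) := by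
    intro n
    have := bregman_step_descent hfbot hσ hFconv hFdiff hgdiff hglip hαlo (hα1 (n + 1))
      (hα2 (n + 1)) (hβ1 (n + 1)) (hβ2 (n + 1)) hμ (hmin (n + 1)) (hfin (n + 1)) (hfin n)
    rw [← hM1, ← hM2] at this
    simp only [he]
    linarith
  have hc : 0 < M1 - M2 := sub_pos.2 hM
  have hanti : Antitone e := antitone_nat_of_succ_le fun n => by
    have := hdesc n
    nlinarith [sq_nonneg ‖x (n + 3) - x (n + 2)‖]
  have hval : ∀ n, H (WithLp.toLp 2 (x (n + 2), x (n + 1))) = (e n : EReal) := by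
    intro n
    rw [hH', WithLp.toLp_fst, WithLp.toLp_snd, ← EReal.coe_toReal (hfin n) (hfbot _),
      ← EReal.coe_add, ← add_assoc]
  obtain ⟨R, hR⟩ := exists_norm_bound_of_coercive hcoer (e 0)
  have hxR : ∀ n, ‖x (n + 2)‖ ≤ R := by
    refine fun n => hR _ ?_
    rw [← EReal.coe_toReal (hfin n) (hfbot _), ← EReal.coe_add, EReal.coe_le_coe_iff]
    refine le_trans ?_ (hanti (Nat.zero_le n))
    simp only [he]
    have : 0 ≤ M2 * ‖x (n + 2) - x (n + 1)‖ ^ 2 := by positivity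
    linarith
  obtain ⟨ℓ, hℓ⟩ : ∃ ℓ, Tendsto e atTop (𝓝 ℓ) := by
    obtain ⟨cl, hcl⟩ := hfbdd
    obtain ⟨B, hB⟩ := (isCompact_closedBall (0 : EuclideanSpace ℝ (Fin m)) R).bddBelow_image
      hgdiff.continuous.continuousOn
    refine ⟨_, tendsto_atTop_ciInf hanti ⟨cl + B, ?_⟩⟩
    rintro _ ⟨n, rfl⟩
    have h1 : B ≤ g (x (n + 2)) :=
      hB (Set.mem_image_of_mem g (mem_closedBall_zero_iff.2 (hxR n)))
    have h2 := hcl (x (n + 2))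
    rw [← EReal.coe_toReal (hfin n) (hfbot _), EReal.coe_le_coe_iff] at h2
    have : 0 ≤ M2 * ‖x (n + 2) - x (n + 1)‖ ^ 2 := by positivity
    simp only [he]
    linarith
  have hd2 : Tendsto (fun n => ‖x (n + 3) - x (n + 2)‖) atTop (𝓝 0) := by
    have h1 : Tendsto (fun n => (e n - e (n + 1)) / (M1 - M2)) atTop (𝓝 0) := by
      simpa using (hℓ.sub (hℓ.comp (tendsto_add_atTop_nat 1))).div_const (M1 - M2)
    have h2 : Tendsto (fun n => ‖x (n + 3) - x (n + 2)‖ ^ 2) atTop (𝓝 0) := by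
      refine squeeze_zero (fun n => by positivity) (fun n => ?_) h1
      rw [le_div_iff₀ hc, mul_comm]
      exact hdesc n
    simpa using h2.sqrt
  have hd1 : Tendsto (fun n => ‖x (n + 2) - x (n + 1)‖) atTop (𝓝 0) :=
    (tendsto_add_atTop_iff_nat 1).1 hd2
  obtain ⟨xb, -, ψ, hψ, hψx⟩ := tendsto_subseq_of_bounded
    (Metric.isBounded_closedBall (x := (0 : EuclideanSpace ℝ (Fin m))) (r := R))
    (x := fun n => x (n + 2)) fun n => mem_closedBall_zero_iff.2 (hxR n)
  have hxψ2 : Tendsto (fun k => x (ψ k + 2)) atTop (𝓝 xb) := hψx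
  have hdψ1 : Tendsto (fun k => ‖x (ψ k + 2) - x (ψ k + 1)‖) atTop (𝓝 0) :=
    hd1.comp hψ.tendsto_atTop
  have hdψ2 : Tendsto (fun k => ‖x (ψ k + 3) - x (ψ k + 2)‖) atTop (𝓝 0) :=
    hd2.comp hψ.tendsto_atTop
  have hxψ1 : Tendsto (fun k => x (ψ k + 1)) atTop (𝓝 xb) := by
    simpa using hxψ2.sub (tendsto_zero_iff_norm_tendsto_zero.2 hdψ1)
  have hxψ3 : Tendsto (fun k => x (ψ k + 3)) atTop (𝓝 xb) := by
    simpa using hxψ2.add (tendsto_zero_iff_norm_tendsto_zero.2 hdψ2)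
  have hgψ : Tendsto (fun k => g (x (ψ k + 3))) atTop (𝓝 (g xb)) :=
    (hgdiff.continuous.tendsto xb).comp hxψ3
  have hxbfin : f xb ≠ ⊤ := by
    intro htop
    obtain ⟨k, hk1, hk2⟩ := ((hxψ3.eventually (hflsc xb ((e 0 - g xb + 1 : ℝ) : EReal)
      (by simpa only [htop] using EReal.coe_lt_top _))).and
      (hgψ.eventually_const_lt (sub_one_lt (g xb)))).exists
    have hk3 : f (x (ψ k + 3)) ≠ ⊤ := hfin (ψ k + 1)
    rw [← EReal.coe_toReal hk3 (hfbot _), gt_iff_lt, EReal.coe_lt_coe_iff] at hk1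
    have h1 : (f (x (ψ k + 3))).toReal + g (x (ψ k + 3)) +
        M2 * ‖x (ψ k + 3) - x (ψ k + 2)‖ ^ 2 ≤ e 0 := hanti (Nat.zero_le (ψ k + 1))
    have : 0 ≤ M2 * ‖x (ψ k + 3) - x (ψ k + 2)‖ ^ 2 := by positivity
    linarith
  have hfψ : Tendsto (fun k => (f (x (ψ k + 3))).toReal) atTop (𝓝 (f xb).toReal) :=
    tendsto_toReal_of_bregman_steps hfbot hflsc hFdiff.continuous
      (continuous_gradient_of_lipschitz hLF.le hFlip) (continuous_gradient_of_lipschitz hLg hglip)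
      hαlo (fun k => hα1 (ψ k + 1)) (fun k => hβ1 (ψ k + 1)) (fun k => hβ2 (ψ k + 1))
      (fun k => hmin (ψ k + 1)) (fun k => hfin (ψ k + 1)) hxbfin hxψ1 hxψ2 hxψ3
  have hℓeq : ℓ = (f xb).toReal + g xb := by
    have h1 : Tendsto (fun k => e (ψ k + 1)) atTop (𝓝 ℓ) :=
      (hℓ.comp (tendsto_add_atTop_nat 1)).comp hψ.tendsto_atTop
    refine tendsto_nhds_unique h1 ?_
    simpa using (hfψ.add hgψ).add ((hdψ2.pow 2).const_mul M2)
  have hsub := fun n => bregman_step_subgradient hfbot hFdiff hFlip hgdiff hglip hM20 hαlo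
    (hα1 n) (hβ1 n) (hβ2 n) (hmin n) (hfin n) hH'
  choose v hv hvn using fun n => (hsub n).1
  choose w hw hwn using fun n => (hsub n).2
  have hHb : H (WithLp.toLp 2 (xb, xb)) = (ℓ : EReal) := by
    rw [hH', hℓeq, EReal.coe_add (f xb).toReal, EReal.coe_toReal hxbfin (hfbot _)]
    simp
  have hbound : ∀ A B : ℝ, Tendsto (fun k => A * ‖x (ψ k + 3) - x (ψ k + 2)‖ +
      B * ‖x (ψ k + 2) - x (ψ k + 1)‖) atTop (𝓝 0) := fun A B => by
    simpa using (hdψ2.const_mul A).add (hdψ1.const_mul B)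
  have hcritH : (0 : WithLp 2 _) ∈ limitingSubdiff H (WithLp.toLp 2 (xb, xb)) := by
    refine ⟨hHb ▸ EReal.coe_ne_top _,
      fun k => WithLp.toLp 2 (x (ψ k + 3), x (ψ k + 2)), fun k => w (ψ k + 1), ?_, ?_,
      fun k => hw (ψ k + 1), squeeze_zero_norm (fun k => hwn (ψ k + 1)) (hbound _ _)⟩
    · exact ((WithLp.prod_continuous_toLp 2 _ _).tendsto (xb, xb)).comp
        (hxψ3.prodMk_nhds hxψ2)
    · rw [hHb]
      have h1 : Tendsto (fun k => e (ψ k + 1)) atTop (𝓝 ℓ) :=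
        (hℓ.comp (tendsto_add_atTop_nat 1)).comp hψ.tendsto_atTop
      exact ((continuous_coe_real_ereal.tendsto ℓ).comp h1).congr fun k => (hval (ψ k + 1)).symm
  have hcrit : (0 : EuclideanSpace ℝ (Fin m)) ∈
      limitingSubdiff (fun w => f w + ((g w : ℝ) : EReal)) xb := by
    have hxbv : f xb + (g xb : EReal) = (((f xb).toReal + g xb : ℝ) : EReal) := by
      rw [EReal.coe_add, EReal.coe_toReal hxbfin (hfbot _)]
    refine ⟨ne_of_eq_of_ne hxbv (EReal.coe_ne_top _), fun k => x (ψ k + 3), fun k => v (ψ k + 1), hxψ3, ?_,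
      fun k => hv (ψ k + 1), squeeze_zero_norm (fun k => hvn (ψ k + 1)) (hbound _ _)⟩
    simp only [hxbv]
    refine ((continuous_coe_real_ereal.tendsto _).comp (hfψ.add hgψ)).congr fun k => ?_
    simp [EReal.coe_toReal (hfin (ψ k + 1)) (hfbot _)]
  have hwC : ∀ n, ‖w (n + 1)‖ ≤ (LF / αlo + Lg + 4 * M2 + β / αlo) *
      (‖x (n + 3) - x (n + 2)‖ + ‖x (n + 2) - x (n + 1)‖) := by
    refine fun n => (hwn (n + 1)).trans ?_
    have h1 : 0 ≤ LF / αlo + Lg + 4 * M2 := by positivity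
    have h2 : 0 ≤ β / αlo := by positivity
    have h3 := norm_nonneg (x (n + 3) - x (n + 2))
    have h4 := norm_nonneg (x (n + 2) - x (n + 1))
    nlinarith [mul_nonneg h1 h4, mul_nonneg h2 h3]
  obtain ⟨hsum, hlim⟩ := summable_and_tendsto_of_KLAt (x := fun n => x (n + 1))
    (C := LF / αlo + Lg + 4 * M2 + β / αlo) hc (by positivity) hval hdesc hℓ
    (fun n => ⟨w (n + 1), frechetSubdiff_subset_limitingSubdiff _ _ (hw (n + 1)), hwC n⟩)
    (ψ := ψ) hψ hxψ1 hd1 hHb (hKL _ ⟨0, hcritH⟩)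
  exact ⟨(summable_nat_add_iff 1).1 hsum, xb, hcrit, (tendsto_add_atTop_iff_nat 1).1 hlim⟩
end
end
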